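/- Let α ∈ ℝ, γ ∈ (1/2,1] and let w : [0,1] → ℝ^d be continuous with K^w_{α,γ} < ∞. Assume that either b ∈ FL^{α+2}, or that α + γ + 1 ≥ 0 and b ∈ FL^{α+γ+1}. Then for every x ∈ ℝ^d there is a unique θ_·(x) ∈ C^{0,γ}([0,1], ℝ^d) solving the Young equation θ_t(x) = x + ∫₀^t (σ^w_{du} b)(θ_u(x)) on [0,1], and the flow is Lipschitz uniformly in time: there is a constant L such that |θ_t(x) − θ_t(y)| ≤ L |x−y| for all t ∈ [0,1] and all x, y ∈ ℝ^d. -/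

import Mathlib

open MeasureTheory Filter Topology
open scoped ENNReal NNReal

noncomputable section

abbrev Euc (d : ℕ) : Type := EuclideanSpace ℝ (Fin d)

/-- `Y^w_{s,t}(ω,ξ) = ∫_s^t exp(i ξ·w_u + i ω u) du`. -/
def Yint {d : ℕ} (w : ℝ → Euc d) (s t ω : ℝ) (ξ : Euc d) : ℂ :=
  ∫ u in s..t, Complex.exp (Complex.I * Complex.ofReal (inner ℝ ξ (w u) + ω * u))

/-- The averaging constant `K^w_{α,γ}`. -/
def avgK {d : ℕ} (w : ℝ → Euc d) (α γ : ℝ) : ℝ≥0∞ :=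
  ⨆ (s : ℝ) (t : ℝ) (_ : 0 ≤ s) (_ : s < t) (_ : t ≤ 1) (ω : ℝ) (ξ : Euc d),
    ENNReal.ofReal (‖Yint w s t ω ξ‖ /
      ((1 + ‖ξ‖) ^ α * (1 + Real.sqrt (Real.log (1 + |ω|))) * (t - s) ^ γ))

/-- The norm `N_α` of a space-time vector field given through its Fourier transform `bhat`. -/
def FLnorm (d : ℕ) (α : ℝ) (bhat : ℝ × Euc d → Fin d → ℂ) : ℝ≥0∞ :=
  ∫⁻ p : ℝ × Euc d, ENNReal.ofReal (‖bhat p‖ * (1 + ‖p.2‖) ^ α *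
    (1 + Real.sqrt (Real.log (1 + |p.1|))))

/-- The vector field `b(t,x)` recovered from its space-time Fourier transform. -/
def fieldOf {d : ℕ} (bhat : ℝ × Euc d → Fin d → ℂ) (t : ℝ) (x : Euc d) : Euc d :=
  (EuclideanSpace.equiv (Fin d) ℝ).symm fun i =>
    ∫ p : ℝ × Euc d, (bhat p i * Complex.exp (Complex.I * Complex.ofReal (p.1 * t + inner ℝ p.2 x))).re

/-- The averaged vector field `σ^w_{[s,t]} b`, defined through the Fourier representation. -/
def sigmaAvg {d : ℕ} (w : ℝ → Euc d) (bhat : ℝ × Euc d → Fin d → ℂ) (s t : ℝ) (x : Euc d) :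
    Euc d :=
  (EuclideanSpace.equiv (Fin d) ℝ).symm fun i =>
    ∫ p : ℝ × Euc d, (bhat p i * Yint w s t p.1 p.2 *
      Complex.exp (Complex.I * Complex.ofReal (inner ℝ p.2 x))).re

/-- Partitions of the interval `[s,t]`. -/
structure TimePartition (s t : ℝ) where
  n : ℕ
  pts : ℕ → ℝ
  first : pts 0 = s
  last : pts n = t
  mono : ∀ i, i < n → pts i ≤ pts (i + 1)

/-- The mesh of the partition is smaller than `δ`. -/
def TimePartition.MeshLt {s t : ℝ} (P : TimePartition s t) (δ : ℝ) : Prop :=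
  ∀ i, i < P.n → P.pts (i + 1) - P.pts i < δ

/-- Riemann sums `Σ_i (G_{t_{i+1}} - G_{t_i})(f_{t_i})` of the nonlinear Young integral. -/
def RiemannSum {V W : Type*} [AddCommGroup W] (G : ℝ → V → W) (f : ℝ → V)
    {s t : ℝ} (P : TimePartition s t) : W :=
  ∑ i ∈ Finset.range P.n, (G (P.pts (i + 1)) (f (P.pts i)) - G (P.pts i) (f (P.pts i)))

/-- `L` is the nonlinear Young integral `∫_s^t G_{du}(f_u)`: the Riemann sums converge to `L`
as the mesh of the partition tends to `0`. -/
def HasYoungIntegral {V W : Type*} [NormedAddCommGroup W] (G : ℝ → V → W) (f : ℝ → V)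
    (s t : ℝ) (L : W) : Prop :=
  ∀ ε > 0, ∃ δ > 0, ∀ P : TimePartition s t, P.MeshLt δ → ‖RiemannSum G f P - L‖ < ε

/-- Riemann sums `Σ_i (σ^w_{[t_i,t_{i+1}]} b)(θ_{t_i})`. -/
def sigmaRiemannSum {d : ℕ} (w : ℝ → Euc d) (bhat : ℝ × Euc d → Fin d → ℂ)
    (θ : ℝ → Euc d) {s t : ℝ} (P : TimePartition s t) : Euc d :=
  ∑ i ∈ Finset.range P.n, sigmaAvg w bhat (P.pts i) (P.pts (i + 1)) (θ (P.pts i))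

/-- `L = ∫_s^t (σ^w_{du} b)(θ_u)` as a limit of Riemann sums. -/
def HasSigmaIntegral {d : ℕ} (w : ℝ → Euc d) (bhat : ℝ × Euc d → Fin d → ℂ)
    (θ : ℝ → Euc d) (s t : ℝ) (L : Euc d) : Prop :=
  ∀ ε > 0, ∃ δ > 0, ∀ P : TimePartition s t, P.MeshLt δ → ‖sigmaRiemannSum w bhat θ P - L‖ < ε

/-- `θ` solves the Young equation `θ_t = x₀ + ∫_0^t (σ^w_{du} b)(θ_u)` on `[0,1]`. -/
def SolvesSigmaYoung {d : ℕ} (w : ℝ → Euc d) (bhat : ℝ × Euc d → Fin d → ℂ)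
    (x₀ : Euc d) (θ : ℝ → Euc d) : Prop :=
  θ 0 = x₀ ∧ ∀ t ∈ Set.Icc (0 : ℝ) 1, HasSigmaIntegral w bhat θ 0 t (θ t - x₀)

/-- `γ`-Hölder continuity on `[0,1]`. -/
def HolderOnIcc {E : Type*} [NormedAddCommGroup E] (γ : ℝ) (f : ℝ → E) : Prop :=
  ∃ C : ℝ, ∀ s ∈ Set.Icc (0 : ℝ) 1, ∀ t ∈ Set.Icc (0 : ℝ) 1, ‖f t - f s‖ ≤ C * |t - s| ^ γ

/-- Covariance of the fractional Brownian motion of Hurst index `H`. -/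
def fbmCov (H : ℝ) (s t : ℝ) : ℝ := (s ^ (2 * H) + t ^ (2 * H) - |t - s| ^ (2 * H)) / 2

/-- `W` is a `d`-dimensional fractional Brownian motion of Hurst parameter `H` with continuous
sample paths: the coordinates are independent centered Gaussian processes with the fBm
covariance, expressed by asking every finite linear combination to be Gaussian. -/
def IsFBM {Ω : Type*} [MeasureSpace Ω] (d : ℕ) (H : ℝ) (W : Ω → ℝ → Euc d) : Prop :=
  (∀ ω, ContinuousOn (W ω) (Set.Icc 0 1)) ∧
  (∀ t, Measurable fun ω => W ω t) ∧
  (∀ ω, W ω 0 = 0) ∧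
  ∀ (n : ℕ) (c : Fin n → ℝ) (t : Fin n → ℝ) (j : Fin n → Fin d),
    (∀ k, t k ∈ Set.Icc (0 : ℝ) 1) →
    Measure.map (fun ω => ∑ k, c k * W ω (t k) (j k)) (volume : Measure Ω) =
      ProbabilityTheory.gaussianReal 0
        (Real.toNNReal (∑ k, ∑ l, c k * c l *
          (if j k = j l then fbmCov H (t k) (t l) else 0)))

/-- `R^w_λ = (∫_0^1 exp(λ |w_u|²) du)^{1/λ}`. -/
def Rconst {d : ℕ} (lam : ℝ) (w : ℝ → Euc d) : ℝ≥0∞ :=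
  (∫⁻ u in Set.Icc (0 : ℝ) 1, ENNReal.ofReal (Real.exp (lam * ‖w u‖ ^ 2))) ^ (1 / lam)

/-- `S^w_λ`. -/
def Sconst {d : ℕ} (H lam : ℝ) (w : ℝ → Euc d) : ℝ≥0∞ :=
  (∑' n : ℕ, ∑' m : ℕ, ∑ k ∈ Finset.range (2 ^ n), ∑' q : ℤ × (Fin d → ℤ),
    ENNReal.ofReal (
      (2 : ℝ) ^ (-(2 * (n : ℝ)) - (m : ℝ) * ((d : ℝ) + 2)) *
      (1 + |(q.1 : ℝ) / 2 ^ m|) ^ (-(2 : ℝ)) *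
      (1 + ‖(EuclideanSpace.equiv (Fin d) ℝ).symm (fun i => (q.2 i : ℝ) / 2 ^ m)‖) ^
        (-((d : ℝ) + 1)) *
      Real.exp (lam * 2 ^ n *
        (1 + ‖(EuclideanSpace.equiv (Fin d) ℝ).symm (fun i => (q.2 i : ℝ) / 2 ^ m)‖) ^ (1 / H) *
        ‖Yint w ((k : ℝ) / 2 ^ n) (((k : ℝ) + 1) / 2 ^ n) ((q.1 : ℝ) / 2 ^ m)
          ((EuclideanSpace.equiv (Fin d) ℝ).symm (fun i => (q.2 i : ℝ) / 2 ^ m))‖ ^ 2))) ^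
  (1 / lam)

/-- `Q^w_λ = √(log S^w_λ) + √(log R^w_λ)`. -/
def Qconst {d : ℕ} (H lam : ℝ) (w : ℝ → Euc d) : ℝ :=
  Real.sqrt (Real.log (Sconst H lam w).toReal) + Real.sqrt (Real.log (Rconst lam w).toReal)

/-- A self-improving bound `f ≤ S g ⟹ f ≤ (A + ρ S) g` with `ρ < 1` yields `f ≤ A / (1 - ρ) g`. -/
theorem le_div_one_sub_mul_of_step {ι : Type*} {f g : ι → ℝ} {A ρ S₀ : ℝ} (hρ : 0 ≤ ρ)
    (hρ1 : ρ < 1) (hA : 0 ≤ A) (hS₀ : 0 ≤ S₀) (hg : ∀ i, 0 ≤ g i)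
    (h₀ : ∀ i, f i ≤ S₀ * g i)
    (step : ∀ S, 0 ≤ S → (∀ i, f i ≤ S * g i) → ∀ i, f i ≤ (A + ρ * S) * g i) (i : ι) :
    f i ≤ A / (1 - ρ) * g i := by
  have h1 : 0 < 1 - ρ := by linarith
  have hAd : 0 ≤ A / (1 - ρ) := by positivity
  have key : ∀ n : ℕ, ∀ i, f i ≤ (A / (1 - ρ) + ρ ^ n * S₀) * g i := by
    intro n
    induction n with
    | zero =>
      intro i
      refine (h₀ i).trans (mul_le_mul_of_nonneg_right ?_ (hg i))
      simpa using hAd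
    | succ n ih =>
      intro i
      refine (step _ (by positivity) ih i).trans_eq ?_
      congr 1
      field_simp
      ring
  have hlim : Tendsto (fun n : ℕ => (A / (1 - ρ) + ρ ^ n * S₀) * g i) atTop
      (𝓝 ((A / (1 - ρ) + 0 * S₀) * g i)) :=
    (((tendsto_pow_atTop_nhds_zero_of_lt_one hρ hρ1).mul_const S₀).const_add _).mul_const _
  simpa using ge_of_tendsto' hlim fun n => key n i

theorem two_rpow_one_sub_lt_one {γ : ℝ} (hγ : 1 / 2 < γ) : (2 : ℝ) ^ (1 - 2 * γ) < 1 :=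
  Real.rpow_lt_one_of_one_lt_of_neg (by norm_num) (by linarith)

theorem half_rpow_add_half_rpow {r γ : ℝ} (hr : 0 ≤ r) :
    (r / 2) ^ (2 * γ) + (r / 2) ^ (2 * γ) = (2 : ℝ) ^ (1 - 2 * γ) * r ^ (2 * γ) := by
  rw [Real.div_rpow hr (by norm_num), Real.rpow_sub (by norm_num), Real.rpow_one]
  ring

/-- The geometric constant of the midpoint sewing argument. -/
def sewConst (γ : ℝ) : ℝ := 1 / (1 - (2 : ℝ) ^ (1 - 2 * γ))

theorem sewConst_pos {γ : ℝ} (hγ : 1 / 2 < γ) : 0 < sewConst γ := by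
  have := two_rpow_one_sub_lt_one hγ
  unfold sewConst
  have : 0 < 1 - (2 : ℝ) ^ (1 - 2 * γ) := by linarith
  positivity

section Abstract

variable {E : Type*} [NormedAddCommGroup E]

/-- A remainder of order `2γ > 1` is controlled by its defect of additivity at midpoints. -/
theorem norm_remainder_le {γ a b C A : ℝ} (hγ : 1 / 2 < γ) (hA : 0 ≤ A) {R : ℝ → ℝ → E}
    (hC : ∀ s t, a ≤ s → s ≤ t → t ≤ b → ‖R s t‖ ≤ C * (t - s) ^ (2 * γ))
    (hR : ∀ s t, a ≤ s → s ≤ t → t ≤ b →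
      ‖R s t - R s ((s + t) / 2) - R ((s + t) / 2) t‖ ≤ A * (t - s) ^ (2 * γ))
    {s t : ℝ} (hs : a ≤ s) (hst : s ≤ t) (ht : t ≤ b) :
    ‖R s t‖ ≤ sewConst γ * A * (t - s) ^ (2 * γ) := by
  have hnn : ∀ {s t : ℝ}, s ≤ t → 0 ≤ (t - s) ^ (2 * γ) := fun h =>
    Real.rpow_nonneg (by linarith) _
  let ι := {p : ℝ × ℝ // a ≤ p.1 ∧ p.1 ≤ p.2 ∧ p.2 ≤ b}
  have := le_div_one_sub_mul_of_step (ι := ι) (f := fun p => ‖R p.1.1 p.1.2‖)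
    (g := fun p => (p.1.2 - p.1.1) ^ (2 * γ)) (A := A) (ρ := (2 : ℝ) ^ (1 - 2 * γ)) (S₀ := |C|)
    (by positivity) (two_rpow_one_sub_lt_one hγ) hA (abs_nonneg _)
    (fun p => hnn p.2.2.1)
    (fun p => (hC _ _ p.2.1 p.2.2.1 p.2.2.2).trans
      (mul_le_mul_of_nonneg_right (le_abs_self C) (hnn p.2.2.1)))
    (by
      rintro S hS h ⟨⟨s, t⟩, h1, h2, h3⟩
      simp only at h1 h2 h3 ⊢
      have e1 := h ⟨⟨s, (s + t) / 2⟩, h1, by simp only; linarith, by simp only; linarith⟩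
      have e2 := h ⟨⟨(s + t) / 2, t⟩, by simp only; linarith, by simp only; linarith, h3⟩
      simp only at e1 e2
      rw [show (s + t) / 2 - s = (t - s) / 2 by ring] at e1
      rw [show t - (s + t) / 2 = (t - s) / 2 by ring] at e2
      have e3 := hR s t h1 h2 h3
      have e4 := half_rpow_add_half_rpow (γ := γ) (sub_nonneg.2 h2)
      calc ‖R s t‖ = ‖(R s t - R s ((s + t) / 2) - R ((s + t) / 2) t) +
            (R s ((s + t) / 2) + R ((s + t) / 2) t)‖ := by congr 1; abel
        _ ≤ _ := (norm_add_le _ _).trans (add_le_add e3 ((norm_add_le _ _).trans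
            (add_le_add e1 e2)))
        _ = _ := by rw [← mul_add, e4]; ring)
    ⟨⟨s, t⟩, hs, hst, ht⟩
  refine this.trans_eq ?_
  simp only [sewConst]
  ring

/-- Increments `σ s t` of an averaged field, `γ`-Hölder in time with values in `C^{1,ν}` and
`κ`-Hölder in time with values in bounded fields. -/
structure IsDriver (M γ κ ν : ℝ) (σ : ℝ → ℝ → E → E) : Prop where
  add : ∀ s u t x, 0 ≤ s → s ≤ u → u ≤ t → t ≤ 1 → σ s t x = σ s u x + σ u t x
  bdd : ∀ s t x, 0 ≤ s → s ≤ t → t ≤ 1 → ‖σ s t x‖ ≤ M * (t - s) ^ κ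
  lip : ∀ s t x y, 0 ≤ s → s ≤ t → t ≤ 1 → ‖σ s t x - σ s t y‖ ≤ M * (t - s) ^ γ * ‖x - y‖
  dbl : ∀ s t x y p q, 0 ≤ s → s ≤ t → t ≤ 1 →
    ‖σ s t x - σ s t y - (σ s t p - σ s t q)‖ ≤
      M * (t - s) ^ γ * (‖(x - y) - (p - q)‖ + ‖y - q‖ ^ ν * ‖p - q‖)

/-- `θ` solves the Young equation driven by `σ`, in the sense of first order expansions. -/
def IsGermSol (γ : ℝ) (σ : ℝ → ℝ → E → E) (θ : ℝ → E) : Prop :=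
  ∃ C : ℝ, ∀ s t, 0 ≤ s → s ≤ t → t ≤ 1 →
    ‖θ t - θ s - σ s t (θ s)‖ ≤ C * (t - s) ^ (2 * γ)

/-- Admissible exponents. -/
structure Exponents (γ κ ν : ℝ) : Prop where
  half_lt : 1 / 2 < γ
  le : γ ≤ κ
  le_one : κ ≤ 1
  mul_eq : ν * κ = γ
  nonneg : 0 ≤ ν

theorem rpow_two_mul {r γ : ℝ} (hr : 0 ≤ r) : r ^ (2 * γ) = r ^ γ * r ^ γ := by
  rw [mul_comm, Real.rpow_mul hr, Real.rpow_two, sq]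

theorem exists_nat_mul_inv_rpow_le {γ : ℝ} (hγ : 0 < γ) (c : ℝ) :
    ∃ N : ℕ, 0 < N ∧ c * (1 / (N : ℝ)) ^ γ ≤ 1 / 2 := by
  have h : Tendsto (fun N : ℕ => c * (1 / (N : ℝ)) ^ γ) atTop (𝓝 (c * 0 ^ γ)) :=
    ((tendsto_one_div_atTop_nhds_zero_nat).rpow_const (Or.inr hγ.le)).const_mul c
  rw [Real.zero_rpow hγ.ne', mul_zero] at h
  obtain ⟨N, h1, h2⟩ := ((eventually_gt_atTop 0).and
    (h.eventually (eventually_le_nhds (by norm_num : (0 : ℝ) < 1 / 2)))).exists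
  exact ⟨N, h1, h2⟩

/-- Local Hölder continuity at scale `1 / N` implies global Hölder continuity. -/
theorem holder_of_local {γ S : ℝ} (hγ : 0 < γ) (hS : 0 ≤ S) {N : ℕ} (hN : 0 < N) {θ : ℝ → E}
    (h : ∀ s t : ℝ, 0 ≤ s → s ≤ t → t ≤ 1 → t - s ≤ 1 / N → ‖θ t - θ s‖ ≤ S * (t - s) ^ γ)
    {s t : ℝ} (hs : 0 ≤ s) (hst : s ≤ t) (ht : t ≤ 1) :
    ‖θ t - θ s‖ ≤ N * S * (t - s) ^ γ := by
  have hN' : (0 : ℝ) < N := by exact_mod_cast hN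
  let τ : ℕ → ℝ := fun k => s + k * ((t - s) / N)
  have hd : 0 ≤ (t - s) / N := div_nonneg (by linarith) hN'.le
  have hτN : τ N = t := by simp only [τ]; field_simp; ring
  have hτ0 : τ 0 = s := by simp [τ]
  have hsum : θ t - θ s = ∑ k ∈ Finset.range N, (θ (τ (k + 1)) - θ (τ k)) := by
    rw [Finset.sum_range_sub (fun k => θ (τ k)), hτN, hτ0]
  have hdiff : ∀ k, τ (k + 1) - τ k = (t - s) / N := by intro k; simp only [τ]; push_cast; ring
  rw [hsum]
  refine (norm_sum_le _ _).trans ?_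
  have : ∀ k ∈ Finset.range N, ‖θ (τ (k + 1)) - θ (τ k)‖ ≤ S * (t - s) ^ γ := by
    intro k hk
    have hk' : ((k + 1 : ℕ) : ℝ) ≤ N := by exact_mod_cast Finset.mem_range.1 hk
    have h1 : τ (k + 1) ≤ t := by
      rw [← hτN]; simp only [τ]
      have := mul_le_mul_of_nonneg_right hk' hd
      linarith
    have h2 : (t - s) / N ≤ 1 / N := by gcongr; linarith
    refine (h (τ k) (τ (k + 1)) (by simp only [τ]; positivity) (by linarith [hdiff k])
      (h1.trans ht) ((hdiff k).trans_le h2)).trans ?_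
    rw [hdiff]
    gcongr
    exact div_le_self (by linarith) (by exact_mod_cast hN)
  refine (Finset.sum_le_card_nsmul _ _ _ this).trans_eq ?_
  simp [mul_assoc]

/-- A priori bounds for solutions, depending only on the constants of the driver. -/
theorem IsDriver.exists_apriori {M γ κ ν : ℝ} (hM : 0 ≤ M) (he : Exponents γ κ ν) :
    ∃ A : ℝ, 0 ≤ A ∧ ∀ (σ : ℝ → ℝ → E → E) (θ : ℝ → E), IsDriver M γ κ ν σ → IsGermSol γ σ θ →
      ∀ s t, 0 ≤ s → s ≤ t → t ≤ 1 →
        ‖θ t - θ s - σ s t (θ s)‖ ≤ A * (t - s) ^ (2 * γ) ∧ ‖θ t - θ s‖ ≤ A * (t - s) ^ κ := by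
  have hγ := he.half_lt
  have hc := sewConst_pos hγ
  obtain ⟨N, hN, hNle⟩ := exists_nat_mul_inv_rpow_le (γ := γ) (by linarith) (sewConst γ * M)
  have hN' : (0 : ℝ) < N := by exact_mod_cast hN
  refine ⟨M + sewConst γ * (M * (N * (2 * M))), by positivity, ?_⟩
  rintro σ θ hσ ⟨C, hC⟩
  have hpow : ∀ {r : ℝ}, 0 ≤ r → r ≤ 1 → r ^ κ ≤ r ^ γ := fun h0 h1 =>
    Real.rpow_le_rpow_of_exponent_ge_of_imp h0 h1 he.le (by intros; linarith [he.le])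
  have hpow2 : ∀ {r : ℝ}, 0 ≤ r → r ≤ 1 → r ^ (2 * γ) ≤ r ^ κ := fun h0 h1 =>
    Real.rpow_le_rpow_of_exponent_ge_of_imp h0 h1 (by linarith [he.le_one])
      (by intros; linarith [he.le])
  have hrem : ∀ {a b S : ℝ}, 0 ≤ a → b ≤ 1 → 0 ≤ S →
      (∀ s t, a ≤ s → s ≤ t → t ≤ b → ‖θ t - θ s‖ ≤ S * (t - s) ^ γ) →
      ∀ s t, a ≤ s → s ≤ t → t ≤ b →
        ‖θ t - θ s - σ s t (θ s)‖ ≤ sewConst γ * (M * S) * (t - s) ^ (2 * γ) := by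
    intro a b S ha hb hS h s t hs hst ht
    refine norm_remainder_le (R := fun s t => θ t - θ s - σ s t (θ s)) (a := a) (b := b) hγ
      (by positivity) (fun s t h1 h2 h3 => hC s t (by linarith) h2 (by linarith)) ?_ hs hst ht
    intro s t h1 h2 h3
    have e := hσ.add s ((s + t) / 2) t (θ s) (by linarith) (by linarith) (by linarith)
      (by linarith)
    have : (θ t - θ s - σ s t (θ s) - (θ ((s + t) / 2) - θ s - σ s ((s + t) / 2) (θ s)) -
        (θ t - θ ((s + t) / 2) - σ ((s + t) / 2) t (θ ((s + t) / 2)))) =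
        σ ((s + t) / 2) t (θ ((s + t) / 2)) - σ ((s + t) / 2) t (θ s) := by rw [e]; abel
    rw [this, rpow_two_mul (by linarith)]
    refine (hσ.lip _ _ _ _ (by linarith) (by linarith) (by linarith)).trans ?_
    have e1 : ‖θ ((s + t) / 2) - θ s‖ ≤ S * (t - s) ^ γ :=
      (h s _ h1 (by linarith) (by linarith)).trans (by gcongr <;> linarith)
    have e2 : (t - (s + t) / 2) ^ γ ≤ (t - s) ^ γ := by
      gcongr <;> linarith
    have hp : 0 ≤ (t - s) ^ γ := Real.rpow_nonneg (by linarith) _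
    calc M * (t - (s + t) / 2) ^ γ * ‖θ ((s + t) / 2) - θ s‖
        ≤ M * (t - s) ^ γ * (S * (t - s) ^ γ) := by gcongr
      _ = _ := by ring
  have hloc : ∀ s t : ℝ, 0 ≤ s → s ≤ t → t ≤ 1 → t - s ≤ 1 / N →
      ‖θ t - θ s‖ ≤ 2 * M * (t - s) ^ γ := by
    let ι := {p : ℝ × ℝ // 0 ≤ p.1 ∧ p.1 ≤ p.2 ∧ p.2 ≤ 1 ∧ p.2 - p.1 ≤ 1 / N}
    intro s t hs hst ht htN
    have := le_div_one_sub_mul_of_step (ι := ι) (f := fun p => ‖θ p.1.2 - θ p.1.1‖)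
      (g := fun p => (p.1.2 - p.1.1) ^ γ) (A := M) (ρ := 1 / 2) (S₀ := |C| + M)
      (by norm_num) (by norm_num) hM (by positivity)
      (fun p => Real.rpow_nonneg (by linarith [p.2.2.1]) _)
      (by
        rintro ⟨⟨s, t⟩, h1, h2, h3, h4⟩
        simp only at h1 h2 h3 h4 ⊢
        have q0 : 0 ≤ t - s := by linarith
        have q1 : t - s ≤ 1 := by linarith
        have e1 := hC s t h1 h2 h3
        have e2 := hσ.bdd s t (θ s) h1 h2 h3
        calc ‖θ t - θ s‖ = ‖(θ t - θ s - σ s t (θ s)) + σ s t (θ s)‖ := by congr 1; abel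
          _ ≤ C * (t - s) ^ (2 * γ) + M * (t - s) ^ κ := (norm_add_le _ _).trans (add_le_add e1 e2)
          _ ≤ |C| * (t - s) ^ γ + M * (t - s) ^ γ := by
              refine add_le_add (mul_le_mul (le_abs_self C) ((hpow2 q0 q1).trans (hpow q0 q1))
                (by positivity) (by positivity)) (mul_le_mul_of_nonneg_left (hpow q0 q1) hM)
          _ = _ := by ring)
      (by
        rintro S hS h ⟨⟨s, t⟩, h1, h2, h3, h4⟩
        simp only at h1 h2 h3 h4 ⊢
        have q0 : 0 ≤ t - s := by linarith
        have q1 : t - s ≤ 1 := by linarith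
        have e1 := hrem (a := s) (b := t) h1 h3 hS (fun s' t' a1 a2 a3 =>
          h ⟨⟨s', t'⟩, by simp only; linarith, a2, by simp only; linarith,
            by simp only; linarith⟩) s t le_rfl h2 le_rfl
        have e2 := hσ.bdd s t (θ s) h1 h2 h3
        have hp : 0 ≤ (t - s) ^ γ := Real.rpow_nonneg q0 _
        have e3 : (t - s) ^ γ ≤ (1 / (N : ℝ)) ^ γ := by gcongr
        have e4 : sewConst γ * M * (t - s) ^ γ ≤ 1 / 2 :=
          (mul_le_mul_of_nonneg_left e3 (by positivity)).trans hNle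
        calc ‖θ t - θ s‖ = ‖(θ t - θ s - σ s t (θ s)) + σ s t (θ s)‖ := by congr 1; abel
          _ ≤ sewConst γ * (M * S) * (t - s) ^ (2 * γ) + M * (t - s) ^ κ :=
              (norm_add_le _ _).trans (add_le_add e1 e2)
          _ ≤ (sewConst γ * M * (t - s) ^ γ) * (S * (t - s) ^ γ) + M * (t - s) ^ γ := by
              rw [rpow_two_mul q0]
              refine add_le_add (le_of_eq (by ring)) (mul_le_mul_of_nonneg_left (hpow q0 q1) hM)
          _ ≤ 1 / 2 * (S * (t - s) ^ γ) + M * (t - s) ^ γ := by gcongr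
          _ = _ := by ring)
      ⟨⟨s, t⟩, hs, hst, ht, htN⟩
    refine this.trans_eq ?_
    ring
  have hglob := fun s t (hs : 0 ≤ s) (hst : s ≤ t) (ht : t ≤ 1) =>
    holder_of_local (by linarith) (by positivity : 0 ≤ 2 * M) hN hloc hs hst ht
  intro s t hs hst ht
  have q0 : 0 ≤ t - s := by linarith
  have q1 : t - s ≤ 1 := by linarith
  have e1 := hrem le_rfl le_rfl (by positivity) hglob s t hs hst ht
  have e2 := hσ.bdd s t (θ s) hs hst ht
  refine ⟨e1.trans ?_, ?_⟩
  · gcongr; linarith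
  · calc ‖θ t - θ s‖ = ‖(θ t - θ s - σ s t (θ s)) + σ s t (θ s)‖ := by congr 1; abel
      _ ≤ sewConst γ * (M * (N * (2 * M))) * (t - s) ^ (2 * γ) + M * (t - s) ^ κ :=
          (norm_add_le _ _).trans (add_le_add e1 e2)
      _ ≤ sewConst γ * (M * (N * (2 * M))) * (t - s) ^ κ + M * (t - s) ^ κ := by
          have := hpow2 q0 q1
          gcongr ?_ + _
          exact mul_le_mul_of_nonneg_left this (by positivity)
      _ = _ := by ring

/-- `σ` and `σ'` are `ε`-close as `γ`-Hölder functions of time with values in Lipschitz fields. -/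
structure DriverClose (γ ε : ℝ) (σ σ' : ℝ → ℝ → E → E) : Prop where
  bdd : ∀ s t x, 0 ≤ s → s ≤ t → t ≤ 1 → ‖σ s t x - σ' s t x‖ ≤ ε * (t - s) ^ γ
  lip : ∀ s t x y, 0 ≤ s → s ≤ t → t ≤ 1 →
    ‖(σ s t x - σ' s t x) - (σ s t y - σ' s t y)‖ ≤ ε * (t - s) ^ γ * ‖x - y‖

end Abstract

section Abstract

variable {E : Type*} [NormedAddCommGroup E]

set_option maxHeartbeats 1000000 in
/-- Stability on a short time interval. -/
theorem IsDriver.stability_local {M γ κ ν A : ℝ} (hM : 0 ≤ M) (he : Exponents γ κ ν) (hA : 0 ≤ A)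
    {σ σ' : ℝ → ℝ → E → E} {θ ψ : ℝ → E} {ε a b G : ℝ} (hσ : IsDriver M γ κ ν σ)
    (hσ' : IsDriver M γ κ ν σ') (hε : 0 ≤ ε) (hcl : DriverClose γ ε σ σ')
    (hθ : ∀ s t, 0 ≤ s → s ≤ t → t ≤ 1 →
      ‖θ t - θ s - σ s t (θ s)‖ ≤ A * (t - s) ^ (2 * γ) ∧ ‖θ t - θ s‖ ≤ A * (t - s) ^ κ)
    (hψ : ∀ s t, 0 ≤ s → s ≤ t → t ≤ 1 →
      ‖ψ t - ψ s - σ' s t (ψ s)‖ ≤ A * (t - s) ^ (2 * γ) ∧ ‖ψ t - ψ s‖ ≤ A * (t - s) ^ κ)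
    (hG : G = sewConst γ * M + sewConst γ * M * A ^ ν + M + sewConst γ * A + 1)
    (ha : 0 ≤ a) (hab : a ≤ b) (hb : b ≤ 1) (hsmall : G * (b - a) ^ γ ≤ 1 / 2) :
    ‖θ b - ψ b‖ + ε ≤ (1 + 2 * G) * (‖θ a - ψ a‖ + ε) := by
  have hγ := he.half_lt
  have hc := sewConst_pos hγ
  have hν := he.nonneg
  have hAν : 0 ≤ A ^ ν := Real.rpow_nonneg hA _
  have hG0 : 0 ≤ G := by rw [hG]; positivity
  have hpow : ∀ {r : ℝ}, 0 ≤ r → r ≤ 1 → r ^ κ ≤ r ^ γ := fun h0 h1 =>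
    Real.rpow_le_rpow_of_exponent_ge_of_imp h0 h1 he.le (by intros; linarith [he.le])
  have hpow2 : ∀ {r : ℝ}, 0 ≤ r → r ≤ 1 → r ^ (2 * γ) ≤ r ^ κ := fun h0 h1 =>
    Real.rpow_le_rpow_of_exponent_ge_of_imp h0 h1 (by linarith [he.le_one])
      (by intros; linarith [he.le])
  set Δ : ℝ → E := fun t => θ t - ψ t with hΔ
  set D := ‖Δ a‖ with hD
  have hD0 : 0 ≤ D := norm_nonneg _
  set q := (b - a) ^ γ with hq
  have hq0 : 0 ≤ q := Real.rpow_nonneg (by linarith) _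
  have hq1 : q ≤ 1 := Real.rpow_le_one (by linarith) (by linarith) (by linarith)
  let ι := {p : ℝ × ℝ // a ≤ p.1 ∧ p.1 ≤ p.2 ∧ p.2 ≤ b}
  have main := le_div_one_sub_mul_of_step (ι := ι) (f := fun p => ‖Δ p.1.2 - Δ p.1.1‖)
    (g := fun p => (p.1.2 - p.1.1) ^ γ) (A := G * (D + ε)) (ρ := 1 / 2) (S₀ := 2 * A)
    (by norm_num) (by norm_num) (by positivity) (by positivity)
    (fun p => Real.rpow_nonneg (by linarith [p.2.2.1]) _)
    (by
      rintro ⟨⟨s, t⟩, h1, h2, h3⟩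
      simp only at h1 h2 h3 ⊢
      have q0 : 0 ≤ t - s := by linarith
      have q1 : t - s ≤ 1 := by linarith
      have e1 := (hθ s t (by linarith) h2 (by linarith)).2
      have e2 := (hψ s t (by linarith) h2 (by linarith)).2
      calc ‖Δ t - Δ s‖ = ‖(θ t - θ s) - (ψ t - ψ s)‖ := by congr 1; simp only [hΔ]; abel
        _ ≤ A * (t - s) ^ κ + A * (t - s) ^ κ := (norm_sub_le _ _).trans (add_le_add e1 e2)
        _ = 2 * A * (t - s) ^ κ := by ring
        _ ≤ _ := mul_le_mul_of_nonneg_left (hpow q0 q1) (by positivity))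
    (by
      rintro S hS h ⟨⟨s, t⟩, h1, h2, h3⟩
      simp only at h1 h2 h3 ⊢
      replace h : ∀ s t, a ≤ s → s ≤ t → t ≤ b → ‖Δ t - Δ s‖ ≤ S * (t - s) ^ γ :=
        fun s t h1 h2 h3 => h ⟨⟨s, t⟩, h1, h2, h3⟩
      have hsup : ∀ s, a ≤ s → s ≤ b → ‖Δ s‖ ≤ D + S * q := by
        intro s h1 h2
        have e := h a s le_rfl h1 h2
        have e' : (s - a) ^ γ ≤ q := by rw [hq]; gcongr
        calc ‖Δ s‖ = ‖Δ a + (Δ s - Δ a)‖ := by congr 1; abel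
          _ ≤ D + S * (s - a) ^ γ := (norm_add_le _ _).trans (add_le_add le_rfl e)
          _ ≤ _ := by gcongr
      have hrem := norm_remainder_le
        (R := fun s t => Δ t - Δ s - (σ s t (θ s) - σ' s t (ψ s))) (a := a) (b := b)
        (C := 2 * A) (A := M * S + M * A ^ ν * (D + S) + ε * A) hγ (by positivity)
        (by
          intro s t h1 h2 h3
          have e1 := (hθ s t (by linarith) h2 (by linarith)).1
          have e2 := (hψ s t (by linarith) h2 (by linarith)).1
          calc ‖Δ t - Δ s - (σ s t (θ s) - σ' s t (ψ s))‖
              = ‖(θ t - θ s - σ s t (θ s)) - (ψ t - ψ s - σ' s t (ψ s))‖ := by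
                congr 1; simp only [hΔ]; abel
            _ ≤ A * (t - s) ^ (2 * γ) + A * (t - s) ^ (2 * γ) :=
                (norm_sub_le _ _).trans (add_le_add e1 e2)
            _ = _ := by ring)
        (by
          intro s t h1 h2 h3
          set m := (s + t) / 2 with hm
          have hsm : s ≤ m := by linarith
          have hmt : m ≤ t := by linarith
          have f1 := hσ.add s m t (θ s) (by linarith) hsm hmt (by linarith)
          have f2 := hσ'.add s m t (ψ s) (by linarith) hsm hmt (by linarith)
          have split : Δ t - Δ s - (σ s t (θ s) - σ' s t (ψ s)) -
              (Δ m - Δ s - (σ s m (θ s) - σ' s m (ψ s))) -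
              (Δ t - Δ m - (σ m t (θ m) - σ' m t (ψ m))) =
              (σ m t (θ m) - σ m t (ψ m) - (σ m t (θ s) - σ m t (ψ s))) +
              ((σ m t (ψ m) - σ' m t (ψ m)) - (σ m t (ψ s) - σ' m t (ψ s))) := by
            rw [f1, f2]; abel
          rw [split, rpow_two_mul (by linarith)]
          have g1 := hσ.dbl m t (θ m) (ψ m) (θ s) (ψ s) (by linarith) hmt (by linarith)
          have g2 := hcl.lip m t (ψ m) (ψ s) (by linarith) hmt (by linarith)
          have hp : 0 ≤ (t - s) ^ γ := Real.rpow_nonneg (by linarith) _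
          have g3 : (t - m) ^ γ ≤ (t - s) ^ γ := by gcongr
          have g4 : (m - s) ^ γ ≤ (t - s) ^ γ := by gcongr
          have g5 : ‖θ m - ψ m - (θ s - ψ s)‖ ≤ S * (t - s) ^ γ :=
            (h s m h1 hsm (by linarith)).trans (by gcongr)
          have g6 : ‖ψ m - ψ s‖ ≤ A * (m - s) ^ κ := (hψ s m (by linarith) hsm (by linarith)).2
          have g7 : ‖ψ m - ψ s‖ ≤ A * (t - s) ^ γ := g6.trans
            (mul_le_mul_of_nonneg_left ((hpow (by linarith) (by linarith)).trans g4) hA)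
          have g8 : ‖ψ m - ψ s‖ ^ ν ≤ A ^ ν * (t - s) ^ γ := by
            calc ‖ψ m - ψ s‖ ^ ν ≤ (A * (m - s) ^ κ) ^ ν := by gcongr
              _ = A ^ ν * (m - s) ^ γ := by
                rw [Real.mul_rpow hA (Real.rpow_nonneg (by linarith) _),
                  ← Real.rpow_mul (by linarith), mul_comm κ, he.mul_eq]
              _ ≤ _ := by gcongr
          have g9 : ‖θ s - ψ s‖ ≤ D + S :=
            (hsup s h1 (by linarith)).trans (by nlinarith)
          have hp' : 0 ≤ (t - m) ^ γ := Real.rpow_nonneg (by linarith) _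
          refine (norm_add_le _ _).trans ?_
          calc _ ≤ M * (t - m) ^ γ * (‖θ m - ψ m - (θ s - ψ s)‖ +
                ‖ψ m - ψ s‖ ^ ν * ‖θ s - ψ s‖) + ε * (t - m) ^ γ * ‖ψ m - ψ s‖ := add_le_add g1 g2
            _ ≤ M * (t - s) ^ γ * (S * (t - s) ^ γ + (A ^ ν * (t - s) ^ γ) * (D + S)) +
                ε * (t - s) ^ γ * (A * (t - s) ^ γ) := by gcongr
            _ = _ := by ring) h1 h2 h3
      have q0 : 0 ≤ t - s := by linarith
      have hts : (t - s) ^ γ ≤ q := by rw [hq]; gcongr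
      have hp : 0 ≤ (t - s) ^ γ := Real.rpow_nonneg q0 _
      have k1 := hσ.lip s t (θ s) (ψ s) (by linarith) h2 (by linarith)
      have k2 := hcl.bdd s t (ψ s) (by linarith) h2 (by linarith)
      have k3 := hsup s h1 (by linarith)
      rw [rpow_two_mul q0] at hrem
      calc ‖Δ t - Δ s‖ = ‖(Δ t - Δ s - (σ s t (θ s) - σ' s t (ψ s))) +
            ((σ s t (θ s) - σ s t (ψ s)) + (σ s t (ψ s) - σ' s t (ψ s)))‖ := by
            congr 1; abel
        _ ≤ sewConst γ * (M * S + M * A ^ ν * (D + S) + ε * A) * ((t - s) ^ γ * (t - s) ^ γ) +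
            (M * (t - s) ^ γ * ‖θ s - ψ s‖ + ε * (t - s) ^ γ) :=
            (norm_add_le _ _).trans (add_le_add hrem ((norm_add_le _ _).trans (add_le_add k1 k2)))
        _ ≤ sewConst γ * (M * S + M * A ^ ν * (D + S) + ε * A) * (q * (t - s) ^ γ) +
            (M * (t - s) ^ γ * (D + S * q) + ε * (t - s) ^ γ) := by gcongr
        _ = (S * q * (sewConst γ * M + sewConst γ * M * A ^ ν + M) +
            D * (q * (sewConst γ * M * A ^ ν) + M) + ε * (q * (sewConst γ * A) + 1)) *
              (t - s) ^ γ := by ring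
        _ ≤ (S * q * G + D * G + ε * G) * (t - s) ^ γ := by
            have w1 : 0 ≤ sewConst γ * M * A ^ ν := by positivity
            have w2 : 0 ≤ sewConst γ * A := by positivity
            have w3 : 0 ≤ sewConst γ * M := by positivity
            gcongr
            · rw [hG]; linarith
            · rw [hG]; nlinarith
            · rw [hG]; nlinarith
        _ ≤ _ := by
            refine mul_le_mul_of_nonneg_right ?_ hp
            nlinarith [mul_le_mul_of_nonneg_left hsmall hS])
  have e := main ⟨⟨a, b⟩, le_rfl, hab, le_rfl⟩
  simp only at e
  rw [← hq] at e
  have e2 : ‖Δ b‖ ≤ D + ‖Δ b - Δ a‖ := by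
    calc ‖Δ b‖ = ‖Δ a + (Δ b - Δ a)‖ := by congr 1; abel
      _ ≤ _ := norm_add_le _ _
  have e3 : G * (D + ε) / (1 - 1 / 2) * q ≤ 2 * G * (D + ε) := by
    have : 0 ≤ G * (D + ε) := by positivity
    norm_num
    nlinarith
  change ‖Δ b‖ + ε ≤ _
  linarith

/-- Stability of solutions with respect to the driver and the initial condition. -/
theorem IsDriver.exists_stability {M γ κ ν : ℝ} (hM : 0 ≤ M) (he : Exponents γ κ ν) :
    ∃ L : ℝ, 0 ≤ L ∧ ∀ (σ σ' : ℝ → ℝ → E → E) (θ ψ : ℝ → E) (ε : ℝ), IsDriver M γ κ ν σ →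
      IsDriver M γ κ ν σ' → 0 ≤ ε → DriverClose γ ε σ σ' → IsGermSol γ σ θ → IsGermSol γ σ' ψ →
      ∀ t, 0 ≤ t → t ≤ 1 → ‖θ t - ψ t‖ ≤ L * (‖θ 0 - ψ 0‖ + ε) := by
  obtain ⟨A, hA, hap⟩ := IsDriver.exists_apriori (E := E) hM he
  have hc := sewConst_pos he.half_lt
  have hγ := he.half_lt
  set G := sewConst γ * M + sewConst γ * M * A ^ ν + M + sewConst γ * A + 1 with hG
  have hG0 : 0 ≤ G := by
    have hAν : 0 ≤ A ^ ν := Real.rpow_nonneg hA _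
    rw [hG]; positivity
  obtain ⟨N, hN, hNle⟩ := exists_nat_mul_inv_rpow_le (γ := γ) (by linarith) G
  have hN' : (0 : ℝ) < N := by exact_mod_cast hN
  refine ⟨(1 + 2 * G) ^ N, by positivity, ?_⟩
  intro σ σ' θ ψ ε hσ hσ' hε hcl hθ hψ t ht0 ht1
  have ind : ∀ k : ℕ, ‖θ (k * (t / N)) - ψ (k * (t / N))‖ + ε ≤
      (1 + 2 * G) ^ k * (‖θ 0 - ψ 0‖ + ε) ∨ N < k := by
    intro k
    induction k with
    | zero => left; simp
    | succ k ih =>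
      by_cases hk : N < k + 1
      · exact Or.inr hk
      left
      have ih' := ih.resolve_right (by omega)
      have hd : 0 ≤ t / N := by positivity
      have hk' : ((k + 1 : ℕ) : ℝ) ≤ N := by exact_mod_cast not_lt.1 hk
      have hend : ((k + 1 : ℕ) : ℝ) * (t / N) ≤ 1 := by
        calc ((k + 1 : ℕ) : ℝ) * (t / N) ≤ N * (t / N) := by gcongr
          _ = t := by field_simp
          _ ≤ 1 := ht1
      have hdiff : ((k + 1 : ℕ) : ℝ) * (t / N) - k * (t / N) = t / N := by push_cast; ring
      have := IsDriver.stability_local (a := k * (t / N)) (b := ((k + 1 : ℕ) : ℝ) * (t / N))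
        hM he hA hσ hσ' hε hcl (hap σ θ hσ hθ) (hap σ' ψ hσ' hψ) hG (by positivity)
        (by linarith) hend (by
          rw [hdiff]
          refine le_trans ?_ hNle
          gcongr)
      refine this.trans ?_
      rw [pow_succ', mul_assoc]
      gcongr
  have := (ind N).resolve_right (lt_irrefl _)
  rw [show (N : ℝ) * (t / N) = t by field_simp] at this
  linarith

/-- Solutions for approximating drivers converge to a solution. -/
theorem IsDriver.exists_germSol [CompleteSpace E] {M γ κ ν : ℝ} (hM : 0 ≤ M)
    (he : Exponents γ κ ν)
    {σ : ℝ → ℝ → E → E} (hσ : IsDriver M γ κ ν σ) {σn : ℕ → ℝ → ℝ → E → E}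
    (hσn : ∀ n, IsDriver M γ κ ν (σn n)) {ε : ℕ → ℝ} (hε0 : ∀ n, 0 ≤ ε n)
    (hε : Tendsto ε atTop (𝓝 0)) (hcl : ∀ n, DriverClose γ (ε n) (σn n) σ) (x : E)
    {θn : ℕ → ℝ → E} (h0 : ∀ n, θn n 0 = x) (hsol : ∀ n, IsGermSol γ (σn n) (θn n)) :
    ∃ θ : ℝ → E, θ 0 = x ∧ IsGermSol γ σ θ := by
  obtain ⟨A, hA, hap⟩ := IsDriver.exists_apriori (E := E) hM he
  obtain ⟨L, hL, hst⟩ := IsDriver.exists_stability (E := E) hM he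
  have hclnm : ∀ n m, DriverClose γ (ε n + ε m) (σn n) (σn m) := by
    intro n m
    constructor
    · intro s t y hs hst ht
      have e1 := (hcl n).bdd s t y hs hst ht
      have e2 := (hcl m).bdd s t y hs hst ht
      calc ‖σn n s t y - σn m s t y‖ = ‖(σn n s t y - σ s t y) - (σn m s t y - σ s t y)‖ := by
            congr 1; abel
        _ ≤ _ := (norm_sub_le _ _).trans (add_le_add e1 e2)
        _ = _ := by ring
    · intro s t y z hs hst ht
      have e1 := (hcl n).lip s t y z hs hst ht
      have e2 := (hcl m).lip s t y z hs hst ht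
      calc _ = ‖((σn n s t y - σ s t y) - (σn n s t z - σ s t z)) -
            ((σn m s t y - σ s t y) - (σn m s t z - σ s t z))‖ := by
            congr 1; abel
        _ ≤ _ := (norm_sub_le _ _).trans (add_le_add e1 e2)
        _ = _ := by ring
  have hcauchy : ∀ t, 0 ≤ t → t ≤ 1 → ∃ y, Tendsto (fun n => θn n t) atTop (𝓝 y) := by
    intro t ht0 ht1
    refine cauchySeq_tendsto_of_complete ?_
    rw [Metric.cauchySeq_iff]
    intro r hr
    have : ∀ᶠ n in atTop, L * (2 * ε n) < r / 2 := by
      have := (hε.const_mul 2).const_mul L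
      simp only [mul_zero] at this
      exact this.eventually (eventually_lt_nhds (by positivity))
    obtain ⟨N, hN⟩ := eventually_atTop.1 this
    refine ⟨N, fun m hm n hn => ?_⟩
    have e := hst _ _ _ _ _ (hσn m) (hσn n) (add_nonneg (hε0 m) (hε0 n)) (hclnm m n) (hsol m)
      (hsol n) t ht0 ht1
    rw [h0, h0, sub_self, norm_zero, zero_add] at e
    rw [dist_eq_norm]
    have := hN m hm
    have := hN n hn
    have : 0 ≤ L * ε m := mul_nonneg hL (hε0 m)
    have : 0 ≤ L * ε n := mul_nonneg hL (hε0 n)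
    nlinarith
  choose! θ hθ using hcauchy
  refine ⟨θ, ?_, A, ?_⟩
  · have := hθ 0 le_rfl zero_le_one
    simp only [h0] at this
    exact tendsto_nhds_unique this tendsto_const_nhds
  · intro s t hs hst' ht
    have e1 := hθ s hs (hst'.trans ht)
    have e2 := hθ t (hs.trans hst') ht
    have e3 : Tendsto (fun n => σn n s t (θn n s)) atTop (𝓝 (σ s t (θ s))) := by
      rw [tendsto_iff_norm_sub_tendsto_zero]
      have b : Tendsto (fun n => ε n * (t - s) ^ γ + M * (t - s) ^ γ * ‖θn n s - θ s‖) atTop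
          (𝓝 (0 * (t - s) ^ γ + M * (t - s) ^ γ * 0)) :=
        (hε.mul_const _).add ((tendsto_iff_norm_sub_tendsto_zero.1 e1).const_mul _)
      simp only [zero_mul, mul_zero, add_zero] at b
      refine squeeze_zero (fun _ => norm_nonneg _) (fun n => ?_) b
      calc _ = ‖(σn n s t (θn n s) - σ s t (θn n s)) + (σ s t (θn n s) - σ s t (θ s))‖ := by
            congr 1; abel
        _ ≤ _ := (norm_add_le _ _).trans (add_le_add ((hcl n).bdd s t _ hs hst' ht)
            (hσ.lip s t _ _ hs hst' ht))
    exact le_of_tendsto ((e2.sub e1).sub e3).norm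
      (Eventually.of_forall fun n => (hap _ _ (hσn n) (hsol n) s t hs hst' ht).1)

end Abstract

section Partitions

/-- Concatenation of partitions. -/
def TimePartition.concat {s u t : ℝ} (P : TimePartition s u) (Q : TimePartition u t) :
    TimePartition s t where
  n := P.n + Q.n
  pts i := if i ≤ P.n then P.pts i else Q.pts (i - P.n)
  first := by simp [P.first]
  last := by
    split_ifs with h
    · have : Q.n = 0 := by omega
      have h1 := Q.first
      have h2 := Q.last
      rw [this] at h2
      rw [this, Nat.add_zero, P.last, ← h1, h2]
    · simp [Q.last]
  mono i hi := by
    rcases lt_trichotomy i P.n with h | h | h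
    · rw [if_pos h.le, if_pos (by omega)]
      exact P.mono i h
    · subst h
      rw [if_pos le_rfl, if_neg (by omega), P.last, Nat.add_sub_cancel_left]
      exact Q.first.ge.trans (Q.mono 0 (by omega))
    · rw [if_neg (by omega), if_neg (by omega), Nat.sub_add_comm h.le]
      exact Q.mono _ (by omega)

theorem TimePartition.concat_pts_left {s u t : ℝ} (P : TimePartition s u) (Q : TimePartition u t)
    {i : ℕ} (hi : i ≤ P.n) : (P.concat Q).pts i = P.pts i := by
  simp [TimePartition.concat, hi]

theorem TimePartition.concat_pts_right {s u t : ℝ} (P : TimePartition s u)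
    (Q : TimePartition u t) (i : ℕ) : (P.concat Q).pts (P.n + i) = Q.pts i := by
  rcases Nat.eq_zero_or_pos i with rfl | h
  · simp [TimePartition.concat, P.last, Q.first]
  · simp only [TimePartition.concat]
    rw [if_neg (by omega), Nat.add_sub_cancel_left]

theorem TimePartition.MeshLt.concat {s u t δ : ℝ} {P : TimePartition s u} {Q : TimePartition u t}
    (hP : P.MeshLt δ) (hQ : Q.MeshLt δ) : (P.concat Q).MeshLt δ := by
  intro i hi
  by_cases h : i < P.n
  · rw [TimePartition.concat_pts_left _ _ h.le, TimePartition.concat_pts_left _ _ h]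
    exact hP i h
  · obtain ⟨j, rfl⟩ := Nat.exists_eq_add_of_le (not_lt.1 h)
    rw [add_assoc, TimePartition.concat_pts_right, TimePartition.concat_pts_right]
    exact hQ j (by simpa [TimePartition.concat] using hi)

/-- The trivial partition of `[s,t]`. -/
def TimePartition.single {s t : ℝ} (h : s ≤ t) : TimePartition s t where
  n := 1
  pts i := if i = 0 then s else t
  first := by simp
  last := by simp
  mono i hi := by
    obtain rfl : i = 0 := by omega
    simpa using h

theorem TimePartition.le_pts {s t : ℝ} (P : TimePartition s t) {i : ℕ} (hi : i ≤ P.n) :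
    s ≤ P.pts i := by
  induction i with
  | zero => exact P.first.ge
  | succ i ih => exact (ih (by omega)).trans (P.mono i (by omega))

theorem TimePartition.pts_mono {s t : ℝ} (P : TimePartition s t) {i j : ℕ} (hij : i ≤ j)
    (hj : j ≤ P.n) : P.pts i ≤ P.pts j := by
  induction j, hij using Nat.le_induction with
  | base => exact le_rfl
  | succ j _ ih => exact (ih (by omega)).trans (P.mono j (by omega))

theorem TimePartition.pts_le {s t : ℝ} (P : TimePartition s t) {i : ℕ} (hi : i ≤ P.n) :
    P.pts i ≤ t :=
  (P.pts_mono hi le_rfl).trans P.last.le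

variable {E : Type*} [NormedAddCommGroup E]

/-- Riemann sums `∑ σ_{t_i,t_{i+1}}(θ_{t_i})`. -/
def youngSum (σ : ℝ → ℝ → E → E) (θ : ℝ → E) {s t : ℝ} (P : TimePartition s t) : E :=
  ∑ i ∈ Finset.range P.n, σ (P.pts i) (P.pts (i + 1)) (θ (P.pts i))

theorem youngSum_concat (σ : ℝ → ℝ → E → E) (θ : ℝ → E) {s u t : ℝ} (P : TimePartition s u)
    (Q : TimePartition u t) :
    youngSum σ θ (P.concat Q) = youngSum σ θ P + youngSum σ θ Q := by
  unfold youngSum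
  rw [show (P.concat Q).n = P.n + Q.n from rfl, Finset.sum_range_add]
  congr 1
  · refine Finset.sum_congr rfl fun i hi => ?_
    have := Finset.mem_range.1 hi
    rw [TimePartition.concat_pts_left _ _ this.le, TimePartition.concat_pts_left _ _ this]
  · refine Finset.sum_congr rfl fun i _ => ?_
    rw [add_assoc, TimePartition.concat_pts_right, TimePartition.concat_pts_right]

/-- `L` is the limit of the Riemann sums over partitions of `[s,t]`. -/
def HasYoungLimit (σ : ℝ → ℝ → E → E) (θ : ℝ → E) (s t : ℝ) (L : E) : Prop :=
  ∀ ε > 0, ∃ δ > 0, ∀ P : TimePartition s t, P.MeshLt δ → ‖youngSum σ θ P - L‖ < ε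

theorem IsGermSol.hasYoungLimit {γ : ℝ} (hγ : 1 / 2 < γ) {σ : ℝ → ℝ → E → E} {θ : ℝ → E}
    (h : IsGermSol γ σ θ) {t : ℝ} (ht1 : t ≤ 1) :
    HasYoungLimit σ θ 0 t (θ t - θ 0) := by
  obtain ⟨C, hC⟩ := h
  intro ε hε
  have hlim : Tendsto (fun δ : ℝ => |C| * δ ^ (2 * γ - 1)) (𝓝[>] 0) (𝓝 (|C| * 0 ^ (2 * γ - 1))) :=
    ((tendsto_id.mono_left nhdsWithin_le_nhds).rpow_const (Or.inr (by linarith))).const_mul _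
  rw [Real.zero_rpow (by linarith), mul_zero] at hlim
  obtain ⟨δ, hδ, hδ0⟩ := ((hlim.eventually (eventually_lt_nhds hε)).and
    self_mem_nhdsWithin).exists
  refine ⟨δ, hδ0, fun P hP => ?_⟩
  have hsum : θ t - θ 0 = ∑ k ∈ Finset.range P.n, (θ (P.pts (k + 1)) - θ (P.pts k)) := by
    rw [Finset.sum_range_sub (fun k => θ (P.pts k)), P.first, P.last]
  have hlen : ∑ k ∈ Finset.range P.n, (P.pts (k + 1) - P.pts k) = t := by
    rw [Finset.sum_range_sub, P.first, P.last, sub_zero]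
  rw [hsum, youngSum, ← Finset.sum_sub_distrib]
  refine (norm_sum_le _ _).trans_lt ?_
  have hterm : ∀ k ∈ Finset.range P.n, ‖σ (P.pts k) (P.pts (k + 1)) (θ (P.pts k)) -
      (θ (P.pts (k + 1)) - θ (P.pts k))‖ ≤
      |C| * δ ^ (2 * γ - 1) * (P.pts (k + 1) - P.pts k) := by
    intro k hk
    have hk' := Finset.mem_range.1 hk
    have hm := P.mono k hk'
    have hr : 0 ≤ P.pts (k + 1) - P.pts k := by linarith
    rw [norm_sub_rev]
    refine (hC _ _ (P.le_pts hk'.le) hm ((P.pts_le hk').trans ht1)).trans ?_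
    have : (P.pts (k + 1) - P.pts k) ^ (2 * γ) =
        (P.pts (k + 1) - P.pts k) ^ (2 * γ - 1) * (P.pts (k + 1) - P.pts k) := by
      conv_rhs => rw [← Real.rpow_one (P.pts (k + 1) - P.pts k)]
      rw [Real.rpow_one, ← Real.rpow_add_one' hr (by linarith)]
      congr 1; ring
    rw [this, ← mul_assoc]
    have h2 := (hP k hk').le
    refine mul_le_mul_of_nonneg_right (mul_le_mul (le_abs_self C) ?_ ?_ (abs_nonneg _)) hr
    · exact Real.rpow_le_rpow hr h2 (by linarith)
    · exact Real.rpow_nonneg hr _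
  refine (Finset.sum_le_sum hterm).trans_lt ?_
  rw [← Finset.mul_sum, hlen]
  have : 0 ≤ |C| * δ ^ (2 * γ - 1) := by positivity
  nlinarith

/-- Dyadic Riemann sums along arbitrarily fine partitions. -/
theorem exists_partition_youngSum {γ A : ℝ} (hγ : 1 / 2 < γ) (hA : 0 ≤ A)
    {σ : ℝ → ℝ → E → E} {θ : ℝ → E}
    (hdef : ∀ s u t, 0 ≤ s → s ≤ u → u ≤ t → t ≤ 1 →
      ‖σ s u (θ s) + σ u t (θ u) - σ s t (θ s)‖ ≤ A * (t - s) ^ (2 * γ)) (n : ℕ) :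
    ∀ s t, 0 ≤ s → s ≤ t → t ≤ 1 → ∀ δ > (t - s) / 2 ^ n, ∃ P : TimePartition s t,
      P.MeshLt δ ∧ ‖youngSum σ θ P - σ s t (θ s)‖ ≤ sewConst γ * A * (t - s) ^ (2 * γ) := by
  have hc := sewConst_pos hγ
  induction n with
  | zero =>
    intro s t hs hst ht δ hδ
    refine ⟨TimePartition.single hst, ?_, ?_⟩
    · intro i hi
      obtain rfl : i = 0 := by simpa [TimePartition.single] using hi
      simpa [TimePartition.single] using hδ
    · have : 0 ≤ (t - s) ^ (2 * γ) := Real.rpow_nonneg (by linarith) _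
      simp only [youngSum, TimePartition.single, Finset.range_one, Finset.sum_singleton]
      simp only [zero_add, if_true, one_ne_zero, if_false, sub_self, norm_zero]
      positivity
  | succ n ih =>
    intro s t hs hst ht δ hδ
    have hδ' : (t - s) / 2 / 2 ^ n < δ := by rwa [div_div, ← pow_succ']
    obtain ⟨P, hP, hP'⟩ := ih s ((s + t) / 2) hs (by linarith) (by linarith) δ
      (by rwa [show (s + t) / 2 - s = (t - s) / 2 by ring])
    obtain ⟨Q, hQ, hQ'⟩ := ih ((s + t) / 2) t (by linarith) (by linarith) ht δ
      (by rwa [show t - (s + t) / 2 = (t - s) / 2 by ring])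
    refine ⟨P.concat Q, hP.concat hQ, ?_⟩
    rw [youngSum_concat]
    have e := hdef s ((s + t) / 2) t hs (by linarith) (by linarith) ht
    rw [show (s + t) / 2 - s = (t - s) / 2 by ring] at hP'
    rw [show t - (s + t) / 2 = (t - s) / 2 by ring] at hQ'
    have e4 := half_rpow_add_half_rpow (γ := γ) (sub_nonneg.2 hst)
    have hρ : 0 < 1 - (2 : ℝ) ^ (1 - 2 * γ) := by linarith [two_rpow_one_sub_lt_one hγ]
    generalize (s + t) / 2 = m at *
    calc ‖youngSum σ θ P + youngSum σ θ Q - σ s t (θ s)‖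
        = ‖(youngSum σ θ P - σ s m (θ s)) + (youngSum σ θ Q - σ m t (θ m)) +
          (σ s m (θ s) + σ m t (θ m) - σ s t (θ s))‖ := by congr 1; abel
      _ ≤ _ := norm_add₃_le
      _ ≤ _ := add_le_add (add_le_add hP' hQ') e
      _ = (sewConst γ * (2 : ℝ) ^ (1 - 2 * γ) + 1) * A * (t - s) ^ (2 * γ) := by
          rw [← mul_add, e4]; ring
      _ = _ := by
          rw [show sewConst γ * (2 : ℝ) ^ (1 - 2 * γ) + 1 = sewConst γ by
            unfold sewConst; field_simp; ring]

theorem IsDriver.isGermSol_of_hasYoungLimit {M γ κ ν : ℝ} (hM : 0 ≤ M) (he : Exponents γ κ ν)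
    {σ : ℝ → ℝ → E → E} (hσ : IsDriver M γ κ ν σ) {θ : ℝ → E} (hθ : HolderOnIcc γ θ)
    (h : ∀ t, 0 ≤ t → t ≤ 1 → HasYoungLimit σ θ 0 t (θ t - θ 0)) : IsGermSol γ σ θ := by
  obtain ⟨H, hH⟩ := hθ
  have hγ := he.half_lt
  have hdef : ∀ s u t, 0 ≤ s → s ≤ u → u ≤ t → t ≤ 1 →
      ‖σ s u (θ s) + σ u t (θ u) - σ s t (θ s)‖ ≤ M * |H| * (t - s) ^ (2 * γ) := by
    intro s u t hs hsu hut ht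
    rw [hσ.add s u t (θ s) hs hsu hut ht, rpow_two_mul (by linarith)]
    have e := hσ.lip u t (θ u) (θ s) (by linarith) hut ht
    have e2 := hH s ⟨hs, by linarith⟩ u ⟨by linarith, by linarith⟩
    rw [abs_of_nonneg (by linarith)] at e2
    have p1 : (t - u) ^ γ ≤ (t - s) ^ γ := by gcongr
    have p2 : (u - s) ^ γ ≤ (t - s) ^ γ := by gcongr
    have p3 : 0 ≤ (t - u) ^ γ := Real.rpow_nonneg (by linarith) _
    have p4 : 0 ≤ (u - s) ^ γ := Real.rpow_nonneg (by linarith) _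
    calc _ = ‖σ u t (θ u) - σ u t (θ s)‖ := by congr 1; abel
      _ ≤ M * (t - u) ^ γ * ‖θ u - θ s‖ := e
      _ ≤ M * (t - s) ^ γ * (|H| * (t - s) ^ γ) := by
          have e3 := e2.trans (mul_le_mul (le_abs_self H) p2 p4 (abs_nonneg _))
          have p5 : 0 ≤ (t - s) ^ γ := p3.trans p1
          gcongr
      _ = _ := by ring
  refine ⟨sewConst γ * (M * |H|), fun s t hs hst ht => ?_⟩
  refine le_of_forall_pos_le_add fun ε hε => ?_
  obtain ⟨δ₁, hδ₁, h₁⟩ := h s hs (hst.trans ht) (ε / 2) (by positivity)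
  obtain ⟨δ₂, hδ₂, h₂⟩ := h t (hs.trans hst) ht (ε / 2) (by positivity)
  set δ := min δ₁ δ₂
  have hδ : 0 < δ := lt_min hδ₁ hδ₂
  obtain ⟨n, hn⟩ := exists_pow_lt_of_lt_one hδ (by norm_num : (1 / 2 : ℝ) < 1)
  have hfine : ∀ r : ℝ, r ≤ 1 → δ > r / 2 ^ n := fun r hr => by
    refine lt_of_le_of_lt ?_ hn
    rw [div_pow, one_pow]
    gcongr
  obtain ⟨P, hP, -⟩ := exists_partition_youngSum hγ (by positivity) hdef n 0 s le_rfl hs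
    (hst.trans ht) δ (hfine _ (by linarith))
  obtain ⟨Q, hQ, hQ'⟩ := exists_partition_youngSum hγ (by positivity) hdef n s t hs hst
    ht δ (hfine _ (by linarith))
  have k1 := h₁ P fun i hi => (hP i hi).trans_le (min_le_left _ _)
  have k2 := h₂ (P.concat Q) fun i hi => ((hP.concat hQ) i hi).trans_le (min_le_right _ _)
  rw [youngSum_concat] at k2
  calc ‖θ t - θ s - σ s t (θ s)‖
      = ‖(youngSum σ θ Q - σ s t (θ s)) + (youngSum σ θ P - (θ s - θ 0)) -
        (youngSum σ θ P + youngSum σ θ Q - (θ t - θ 0))‖ := by congr 1; abel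
    _ ≤ (sewConst γ * (M * |H|) * (t - s) ^ (2 * γ) + ε / 2) + ε / 2 :=
        (norm_sub_le _ _).trans (add_le_add ((norm_add_le _ _).trans (add_le_add hQ' k1.le)) k2.le)
    _ = _ := by ring

theorem HasYoungLimit.of_sub_le {γ B : ℝ} (hγ : 0 < γ) {σ σ' : ℝ → ℝ → E → E} {θ : ℝ → E}
    {s t : ℝ} {L : E} (h : HasYoungLimit σ θ s t L)
    (hB : ∀ (P : TimePartition s t) (δ : ℝ), 0 < δ → P.MeshLt δ →
      ‖youngSum σ' θ P - youngSum σ θ P‖ ≤ B * δ ^ γ) : HasYoungLimit σ' θ s t L := by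
  intro ε hε
  obtain ⟨δ₁, hδ₁, h₁⟩ := h (ε / 2) (by positivity)
  have hlim : Tendsto (fun δ : ℝ => B * δ ^ γ) (𝓝[>] 0) (𝓝 (B * 0 ^ γ)) :=
    ((tendsto_id.mono_left nhdsWithin_le_nhds).rpow_const (Or.inr hγ.le)).const_mul _
  rw [Real.zero_rpow hγ.ne', mul_zero] at hlim
  obtain ⟨δ, ⟨hδ, hδ0⟩, hδ'⟩ := (((hlim.eventually (eventually_lt_nhds (half_pos hε))).and
    self_mem_nhdsWithin).and (nhdsWithin_le_nhds (eventually_lt_nhds hδ₁))).exists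
  refine ⟨δ, hδ0, fun P hP => ?_⟩
  have k1 := h₁ P fun i hi => (hP i hi).trans hδ'
  have k2 := hB P δ hδ0 hP
  calc ‖youngSum σ' θ P - L‖ = ‖(youngSum σ' θ P - youngSum σ θ P) + (youngSum σ θ P - L)‖ := by
        congr 1; abel
    _ ≤ _ := norm_add_le _ _
    _ < ε := by linarith

end Partitions

section Fourier

variable {d : ℕ}

/-- The weight `(1 + |ξ|)^β (1 + log^{1/2}(1 + |ω|))`. -/
def flWeight (β : ℝ) (p : ℝ × Euc d) : ℝ :=
  (1 + ‖p.2‖) ^ β * (1 + Real.sqrt (Real.log (1 + |p.1|)))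

theorem one_le_logWeight (ω : ℝ) : 1 ≤ 1 + Real.sqrt (Real.log (1 + |ω|)) := by
  have := Real.sqrt_nonneg (Real.log (1 + |ω|))
  linarith

theorem flWeight_pos (β : ℝ) (p : ℝ × Euc d) : 0 < flWeight β p := by
  unfold flWeight
  have := one_le_logWeight p.1
  positivity

theorem flWeight_mul (β r : ℝ) (p : ℝ × Euc d) :
    flWeight β p * (1 + ‖p.2‖) ^ r = flWeight (β + r) p := by
  unfold flWeight
  rw [Real.rpow_add (by positivity)]
  ring

theorem one_le_flWeight {β : ℝ} (hβ : 0 ≤ β) (p : ℝ × Euc d) : 1 ≤ flWeight β p := by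
  unfold flWeight
  have h1 := one_le_logWeight p.1
  have h2 : 1 ≤ (1 + ‖p.2‖) ^ β := Real.one_le_rpow (by linarith [norm_nonneg p.2]) hβ
  nlinarith

theorem measurable_flWeight (β : ℝ) : Measurable (flWeight β : ℝ × Euc d → ℝ) := by
  unfold flWeight
  fun_prop

theorem FLnorm_eq (β : ℝ) (bhat : ℝ × Euc d → Fin d → ℂ) :
    FLnorm d β bhat = ∫⁻ p, ENNReal.ofReal (‖bhat p‖ * flWeight β p) := by
  simp only [FLnorm, flWeight, mul_assoc]

/-- The pairing of a Fourier transform with a test function `Φ`. -/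
def pairing (bhat : ℝ × Euc d → Fin d → ℂ) (Φ : ℝ × Euc d → ℂ) : Euc d :=
  (EuclideanSpace.equiv (Fin d) ℝ).symm fun i => ∫ p : ℝ × Euc d, (bhat p i * Φ p).re

theorem pairing_apply (bhat : ℝ × Euc d → Fin d → ℂ) (Φ : ℝ × Euc d → ℂ) (i : Fin d) :
    pairing bhat Φ i = ∫ p : ℝ × Euc d, (bhat p i * Φ p).re := rfl

/-- `Φ` grows at most like the weight on the support of `bhat`. -/
def PairBound (bhat : ℝ × Euc d → Fin d → ℂ) (β c : ℝ) (Φ : ℝ × Euc d → ℂ) : Prop :=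
  ∀ p, bhat p ≠ 0 → ‖Φ p‖ ≤ c * flWeight β p

theorem PairBound.norm_le {bhat : ℝ × Euc d → Fin d → ℂ} {β c : ℝ} {Φ : ℝ × Euc d → ℂ}
    (h : PairBound bhat β c Φ) (i : Fin d) (p : ℝ × Euc d) :
    ‖(bhat p i * Φ p).re‖ ≤ c * (‖bhat p‖ * flWeight β p) := by
  refine (Complex.abs_re_le_norm _).trans ?_
  rw [norm_mul]
  by_cases hp : bhat p = 0
  · simp [hp]
  · calc ‖bhat p i‖ * ‖Φ p‖ ≤ ‖bhat p‖ * (c * flWeight β p) :=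
        mul_le_mul (norm_le_pi_norm _ i) (h p hp) (norm_nonneg _) (norm_nonneg _)
      _ = _ := by ring

theorem PairBound.abs_pairing_le {bhat : ℝ × Euc d → Fin d → ℂ} {β c : ℝ} {Φ : ℝ × Euc d → ℂ}
    (h : PairBound bhat β c Φ) (hc : 0 ≤ c) (hb : FLnorm d β bhat < ⊤) (i : Fin d) :
    |pairing bhat Φ i| ≤ c * (FLnorm d β bhat).toReal := by
  rw [pairing_apply, ← Real.norm_eq_abs]
  refine (norm_integral_le_lintegral_norm _).trans ?_
  rw [← ENNReal.toReal_ofReal hc, ← ENNReal.toReal_mul, FLnorm_eq,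
    ← lintegral_const_mul' _ _ ENNReal.ofReal_ne_top]
  refine ENNReal.toReal_mono ?_ (lintegral_mono fun p => ?_)
  · rw [lintegral_const_mul' _ _ ENNReal.ofReal_ne_top, ← FLnorm_eq]
    exact ENNReal.mul_ne_top ENNReal.ofReal_ne_top hb.ne
  · rw [← ENNReal.ofReal_mul hc]
    exact ENNReal.ofReal_le_ofReal (h.norm_le i p)

theorem norm_le_card_mul {v : Euc d} {c : ℝ} (h : ∀ i, |v i| ≤ c) : ‖v‖ ≤ d * c := by
  have h1 : ‖v‖ ≤ ∑ i, ‖v i‖ := by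
    conv_lhs => rw [← (EuclideanSpace.basisFun (Fin d) ℝ).sum_repr v]
    refine (norm_sum_le _ _).trans (Finset.sum_le_sum fun i _ => ?_)
    simp [norm_smul]
  refine h1.trans ((Finset.sum_le_card_nsmul _ _ c fun i _ => h i).trans_eq ?_)
  simp

theorem PairBound.norm_pairing_le {bhat : ℝ × Euc d → Fin d → ℂ} {β c F : ℝ}
    {Φ : ℝ × Euc d → ℂ} (h : PairBound bhat β c Φ) (hc : 0 ≤ c) (hb : FLnorm d β bhat < ⊤)
    (hF : (FLnorm d β bhat).toReal ≤ F) :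
    ‖pairing bhat Φ‖ ≤ d * (c * F) :=
  norm_le_card_mul fun i => (h.abs_pairing_le hc hb i).trans (by gcongr)

/-- Componentwise measurability. -/
def CompMeas (bhat : ℝ × Euc d → Fin d → ℂ) : Prop :=
  ∀ i, AEStronglyMeasurable (fun p => bhat p i) (volume : Measure (ℝ × Euc d))

theorem CompMeas.aestronglyMeasurable {bhat : ℝ × Euc d → Fin d → ℂ} (h : CompMeas bhat) :
    AEStronglyMeasurable bhat (volume : Measure (ℝ × Euc d)) :=
  (aemeasurable_pi_iff.2 fun i => (h i).aemeasurable).aestronglyMeasurable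

theorem CompMeas.integrable_weight {bhat : ℝ × Euc d → Fin d → ℂ} (h : CompMeas bhat) {β : ℝ}
    (hb : FLnorm d β bhat < ⊤) :
    Integrable (fun p : ℝ × Euc d => ‖bhat p‖ * flWeight β p) := by
  refine ⟨h.aestronglyMeasurable.norm.mul (measurable_flWeight β).aestronglyMeasurable, ?_⟩
  rw [hasFiniteIntegral_iff_ofReal (Eventually.of_forall fun p =>
    mul_nonneg (norm_nonneg _) (flWeight_pos β p).le), ← FLnorm_eq]
  exact hb

theorem PairBound.integrable {bhat : ℝ × Euc d → Fin d → ℂ} {β c : ℝ} {Φ : ℝ × Euc d → ℂ}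
    (h : PairBound bhat β c Φ) (hm : CompMeas bhat) (hb : FLnorm d β bhat < ⊤)
    (hΦ : AEStronglyMeasurable Φ) (i : Fin d) :
    Integrable (fun p : ℝ × Euc d => (bhat p i * Φ p).re) := by
  refine ((hm.integrable_weight hb).const_mul c).mono'
    (Complex.continuous_re.comp_aestronglyMeasurable ((hm i).mul hΦ))
    (Eventually.of_forall fun p => h.norm_le i p)

theorem PairBound.pairing_sub {bhat : ℝ × Euc d → Fin d → ℂ} {β c c' : ℝ} {Φ Ψ : ℝ × Euc d → ℂ}
    (h : PairBound bhat β c Φ) (h' : PairBound bhat β c' Ψ) (hm : CompMeas bhat)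
    (hb : FLnorm d β bhat < ⊤)
    (hΦ : AEStronglyMeasurable Φ) (hΨ : AEStronglyMeasurable Ψ) :
    pairing bhat Φ - pairing bhat Ψ = pairing bhat (fun p => Φ p - Ψ p) := by
  ext i
  rw [PiLp.sub_apply, pairing_apply, pairing_apply, pairing_apply,
    ← integral_sub (h.integrable hm hb hΦ i) (h'.integrable hm hb hΨ i)]
  simp [mul_sub]

theorem pairing_sub_left {bhat bhat' : ℝ × Euc d → Fin d → ℂ} {β c c' : ℝ} {Φ : ℝ × Euc d → ℂ}
    (h : PairBound bhat β c Φ) (h' : PairBound bhat' β c' Φ) (hm : CompMeas bhat)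
    (hm' : CompMeas bhat') (hb : FLnorm d β bhat < ⊤) (hb' : FLnorm d β bhat' < ⊤)
    (hΦ : AEStronglyMeasurable Φ) :
    pairing bhat Φ - pairing bhat' Φ = pairing (bhat - bhat') Φ := by
  ext i
  rw [PiLp.sub_apply, pairing_apply, pairing_apply, pairing_apply,
    ← integral_sub (h.integrable hm hb hΦ i) (h'.integrable hm' hb' hΦ i)]
  simp [sub_mul]

theorem PairBound.sub {bhat : ℝ × Euc d → Fin d → ℂ} {β c c' : ℝ} {Φ Ψ : ℝ × Euc d → ℂ}
    (h : PairBound bhat β c Φ) (h' : PairBound bhat β c' Ψ) :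
    PairBound bhat β (c + c') (fun p => Φ p - Ψ p) := fun p hp =>
  (norm_sub_le _ _).trans ((add_le_add (h p hp) (h' p hp)).trans_eq (by ring))

/-- The spatial character `exp(i ξ·x)`. -/
def spaceChar (x : Euc d) (p : ℝ × Euc d) : ℂ :=
  Complex.exp (Complex.I * Complex.ofReal (inner ℝ p.2 x))

theorem norm_spaceChar (x : Euc d) (p : ℝ × Euc d) : ‖spaceChar x p‖ = 1 := by
  rw [spaceChar, mul_comm, Complex.norm_exp_ofReal_mul_I]

theorem continuous_spaceChar (x : Euc d) : Continuous (spaceChar x) := by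
  unfold spaceChar
  fun_prop

theorem spaceChar_add (x y : Euc d) (p : ℝ × Euc d) :
    spaceChar (x + y) p = spaceChar x p * spaceChar y p := by
  simp only [spaceChar, ← Complex.exp_add, inner_add_right]
  push_cast
  ring_nf

theorem norm_spaceChar_sub_one_le (x : Euc d) (p : ℝ × Euc d) :
    ‖spaceChar x p - 1‖ ≤ ‖p.2‖ * ‖x‖ :=
  (Real.norm_exp_I_mul_ofReal_sub_one_le).trans (norm_inner_le_norm _ _)

theorem norm_spaceChar_sub_le (x y : Euc d) (p : ℝ × Euc d) :
    ‖spaceChar x p - spaceChar y p‖ ≤ ‖p.2‖ * ‖x - y‖ := by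
  have : spaceChar x p - spaceChar y p = spaceChar y p * (spaceChar (x - y) p - 1) := by
    rw [mul_sub, ← spaceChar_add]; simp
  rw [this, norm_mul, norm_spaceChar, one_mul]
  exact norm_spaceChar_sub_one_le _ _

theorem norm_spaceChar_sub_le_rpow {ν : ℝ} (hν : 0 ≤ ν) (hν1 : ν ≤ 1) (x y : Euc d)
    (p : ℝ × Euc d) :
    ‖spaceChar x p - spaceChar y p‖ ≤ 2 * ((1 + ‖p.2‖) ^ ν * ‖x - y‖ ^ ν) := by
  have h1 := norm_spaceChar_sub_le x y p
  have h2 : ‖spaceChar x p - spaceChar y p‖ ≤ 2 := by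
    refine (norm_sub_le _ _).trans ?_
    rw [norm_spaceChar, norm_spaceChar]; norm_num
  set a := (1 + ‖p.2‖) * ‖x - y‖ with ha
  have ha0 : 0 ≤ a := by positivity
  have h3 : ‖spaceChar x p - spaceChar y p‖ ≤ a := h1.trans (by rw [ha]; gcongr; linarith)
  rw [← Real.mul_rpow (by positivity) (by positivity), ← ha]
  rcases le_total a 1 with h | h
  · have : a ≤ a ^ ν := by
      rcases ha0.eq_or_lt with h0 | h0
      · rw [← h0]; exact Real.rpow_nonneg le_rfl _
      · simpa using Real.rpow_le_rpow_of_exponent_ge h0 h hν1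
    linarith
  · have : 1 ≤ a ^ ν := Real.one_le_rpow h hν
    linarith

/-- Second order differences of characters. -/
theorem norm_spaceChar_dbl_le {ν : ℝ} (hν : 0 ≤ ν) (hν1 : ν ≤ 1) (x y x' y' : Euc d)
    (p : ℝ × Euc d) :
    ‖spaceChar x p - spaceChar y p - (spaceChar x' p - spaceChar y' p)‖ ≤
      2 * (1 + ‖p.2‖) ^ (1 + ν) * (‖(x - y) - (x' - y')‖ + ‖y - y'‖ ^ ν * ‖x' - y'‖) := by
  have split : spaceChar x p - spaceChar y p - (spaceChar x' p - spaceChar y' p) =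
      spaceChar y p * (spaceChar (x - y) p - spaceChar (x' - y') p) +
        (spaceChar y p - spaceChar y' p) * (spaceChar (x' - y') p - 1) := by
    have e1 : spaceChar x p = spaceChar y p * spaceChar (x - y) p := by
      rw [← spaceChar_add]; simp
    have e2 : spaceChar x' p = spaceChar y' p * spaceChar (x' - y') p := by
      rw [← spaceChar_add]; simp
    rw [e1, e2]; ring
  rw [split]
  refine (norm_add_le _ _).trans ?_
  rw [norm_mul, norm_mul, norm_spaceChar, one_mul]
  have hp : 1 ≤ 1 + ‖p.2‖ := by linarith [norm_nonneg p.2]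
  have hpow : (1 + ‖p.2‖) ^ (1 + ν) = (1 + ‖p.2‖) * (1 + ‖p.2‖) ^ ν := by
    rw [Real.rpow_add (by positivity), Real.rpow_one]
  have h1 := norm_spaceChar_sub_le (x - y) (x' - y') p
  have h2 := norm_spaceChar_sub_le_rpow hν hν1 y y' p
  have h3 := norm_spaceChar_sub_one_le (x' - y') p
  have h4 : 1 ≤ (1 + ‖p.2‖) ^ ν := Real.one_le_rpow hp hν
  have h5 : ‖p.2‖ * ‖x - y - (x' - y')‖ ≤
      2 * (1 + ‖p.2‖) ^ (1 + ν) * ‖x - y - (x' - y')‖ := by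
    gcongr
    rw [hpow]
    nlinarith [norm_nonneg p.2]
  have h6 : ‖spaceChar y p - spaceChar y' p‖ * ‖spaceChar (x' - y') p - 1‖ ≤
      2 * (1 + ‖p.2‖) ^ (1 + ν) * (‖y - y'‖ ^ ν * ‖x' - y'‖) := by
    calc _ ≤ 2 * ((1 + ‖p.2‖) ^ ν * ‖y - y'‖ ^ ν) * ((1 + ‖p.2‖) * ‖x' - y'‖) := by
          gcongr
          exact h3.trans (by gcongr; linarith)
      _ = _ := by rw [hpow]; ring
  calc _ ≤ _ := add_le_add (h1.trans h5) h6
    _ = _ := by ring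

theorem sigmaAvg_eq_pairing (w : ℝ → Euc d) (bhat : ℝ × Euc d → Fin d → ℂ) (s t : ℝ) (x : Euc d) :
    sigmaAvg w bhat s t x =
      pairing bhat (fun p => Yint w s t p.1 p.2 * spaceChar x p) := by
  simp only [sigmaAvg, pairing, spaceChar, mul_assoc]

theorem norm_Yint_le (w : ℝ → Euc d) {s t : ℝ} (hst : s ≤ t) (ω : ℝ) (ξ : Euc d) :
    ‖Yint w s t ω ξ‖ ≤ t - s := by
  have := intervalIntegral.norm_integral_le_of_norm_le_const (a := s) (b := t) (C := 1)
    (f := fun u => Complex.exp (Complex.I * Complex.ofReal (inner ℝ ξ (w u) + ω * u)))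
    (fun u _ => by rw [mul_comm, Complex.norm_exp_ofReal_mul_I])
  rwa [one_mul, abs_of_nonneg (by linarith)] at this

theorem norm_Yint_le_avgK {w : ℝ → Euc d} {α γ : ℝ} (hγ : 0 < γ) (hK : avgK w α γ < ⊤) {s t : ℝ}
    (hs : 0 ≤ s) (hst : s ≤ t) (ht : t ≤ 1) (p : ℝ × Euc d) :
    ‖Yint w s t p.1 p.2‖ ≤ (avgK w α γ).toReal * flWeight α p * (t - s) ^ γ := by
  rcases hst.eq_or_lt with rfl | hlt
  · simp [Yint, Real.zero_rpow hγ.ne']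
  have hpos : 0 < flWeight α p * (t - s) ^ γ :=
    mul_pos (flWeight_pos α p) (Real.rpow_pos_of_pos (by linarith) _)
  have h : ENNReal.ofReal (‖Yint w s t p.1 p.2‖ / (flWeight α p * (t - s) ^ γ)) ≤
      avgK w α γ := by
    unfold avgK flWeight
    exact le_iSup_of_le s <| le_iSup_of_le t <| le_iSup_of_le hs <| le_iSup_of_le hlt <|
      le_iSup_of_le ht <| le_iSup_of_le p.1 <| le_iSup_of_le p.2 le_rfl
  rw [ENNReal.ofReal_le_iff_le_toReal hK.ne, div_le_iff₀ hpos] at h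
  linarith

theorem intervalIntegrable_phase {w : ℝ → Euc d} (hw : ContinuousOn w (Set.Icc 0 1)) {s t : ℝ}
    (hs : 0 ≤ s) (hst : s ≤ t) (ht : t ≤ 1) (ω : ℝ) (ξ : Euc d) :
    IntervalIntegrable (fun u => Complex.exp (Complex.I * Complex.ofReal (inner ℝ ξ (w u) + ω * u)))
      volume s t := by
  refine ContinuousOn.intervalIntegrable ?_
  have : ContinuousOn w (Set.uIcc s t) :=
    hw.mono (by rw [Set.uIcc_of_le hst]; exact Set.Icc_subset_Icc hs ht)
  fun_prop

theorem Yint_add {w : ℝ → Euc d} (hw : ContinuousOn w (Set.Icc 0 1)) {s u t : ℝ}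
    (hs : 0 ≤ s) (hsu : s ≤ u) (hut : u ≤ t) (ht : t ≤ 1) (ω : ℝ) (ξ : Euc d) :
    Yint w s t ω ξ = Yint w s u ω ξ + Yint w u t ω ξ :=
  (intervalIntegral.integral_add_adjacent_intervals
    (intervalIntegrable_phase hw hs hsu (hut.trans ht) ω ξ)
    (intervalIntegrable_phase hw (hs.trans hsu) hut ht ω ξ)).symm

/-- The extension of a path on `[0,1]` by its end values. -/
def extendPath (w : ℝ → Euc d) : ℝ → Euc d := 
  Set.IccExtend zero_le_one (Set.domRestrict (Set.Icc 0 1) w)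

theorem continuous_extendPath {w : ℝ → Euc d} (hw : ContinuousOn w (Set.Icc 0 1)) :
    Continuous (extendPath w) :=
  (continuousOn_iff_continuous_domRestrict.1 hw).Icc_extend'

theorem extendPath_of_mem (w : ℝ → Euc d) {u : ℝ} (hu : u ∈ Set.Icc (0 : ℝ) 1) :
    extendPath w u = w u :=
  Set.IccExtend_of_mem _ _ hu

theorem Yint_extendPath (w : ℝ → Euc d) {s t : ℝ} (hs : 0 ≤ s) (hst : s ≤ t) (ht : t ≤ 1)
    (ω : ℝ) (ξ : Euc d) : Yint (extendPath w) s t ω ξ = Yint w s t ω ξ := by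
  refine intervalIntegral.integral_congr fun u hu => ?_
  rw [Set.uIcc_of_le hst] at hu
  simp only [extendPath_of_mem w ⟨hs.trans hu.1, hu.2.trans ht⟩]

theorem continuous_Yint {w : ℝ → Euc d} (hw : ContinuousOn w (Set.Icc 0 1)) {s t : ℝ}
    (hs : 0 ≤ s) (hst : s ≤ t) (ht : t ≤ 1) :
    Continuous (fun p : ℝ × Euc d => Yint w s t p.1 p.2) := by
  have h1 := continuous_extendPath hw
  simp only [← Yint_extendPath w hs hst ht]
  unfold Yint
  refine intervalIntegral.continuous_parametric_intervalIntegral_of_continuous' ?_ _ _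
  fun_prop

section Driver

variable {α γ κ ν F : ℝ} {w : ℝ → Euc d} {bhat : ℝ × Euc d → Fin d → ℂ}

theorem pairBound_Yint {r : ℝ} (hγ : 0 < γ) (hr : 0 ≤ r) (hK : avgK w α γ < ⊤) {s t : ℝ}
    (hs : 0 ≤ s) (hst : s ≤ t) (ht : t ≤ 1) (x : Euc d) :
    PairBound bhat (α + r) ((avgK w α γ).toReal * (t - s) ^ γ)
      (fun p => Yint w s t p.1 p.2 * spaceChar x p) := by
  intro p _
  rw [norm_mul, norm_spaceChar, mul_one]
  refine (norm_Yint_le_avgK hγ hK hs hst ht p).trans ?_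
  have h1 : flWeight α p ≤ flWeight (α + r) p := by
    rw [← flWeight_mul]
    exact le_mul_of_one_le_right (flWeight_pos _ _).le
      (Real.one_le_rpow (by linarith [norm_nonneg p.2]) hr)
  have hp : 0 ≤ (t - s) ^ γ := Real.rpow_nonneg (by linarith) _
  have hK0 : 0 ≤ (avgK w α γ).toReal := ENNReal.toReal_nonneg
  calc (avgK w α γ).toReal * flWeight α p * (t - s) ^ γ
      ≤ (avgK w α γ).toReal * flWeight (α + r) p * (t - s) ^ γ := by gcongr
    _ = _ := by ring

theorem aestronglyMeasurable_Yint (hw : ContinuousOn w (Set.Icc 0 1)) {s t : ℝ}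
    (hs : 0 ≤ s) (hst : s ≤ t) (ht : t ≤ 1) (x : Euc d) :
    AEStronglyMeasurable (fun p : ℝ × Euc d => Yint w s t p.1 p.2 * spaceChar x p) :=
  ((continuous_Yint hw hs hst ht).mul (continuous_spaceChar x)).aestronglyMeasurable

/-- The averaged field is a driver. -/
theorem isDriver_sigmaAvg (he : Exponents γ κ ν) (hν1 : ν ≤ 1)
    (hκ : κ = γ ∨ (κ = 1 ∧ 0 ≤ α + (1 + ν)))
    (hw : ContinuousOn w (Set.Icc 0 1)) (hK : avgK w α γ < ⊤) (hm : CompMeas bhat)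
    (hb : FLnorm d (α + (1 + ν)) bhat < ⊤) (hF : (FLnorm d (α + (1 + ν)) bhat).toReal ≤ F) :
    IsDriver (d * (2 * ((avgK w α γ).toReal + 1) * F)) γ κ ν (sigmaAvg w bhat) := by
  have hν := he.nonneg
  have hγ : 0 < γ := by linarith [he.half_lt]
  have hF0 : 0 ≤ F := ENNReal.toReal_nonneg.trans hF
  set K := (avgK w α γ).toReal with hKdef
  have hK0 : 0 ≤ K := ENNReal.toReal_nonneg
  have hone : ∀ p : ℝ × Euc d, 1 ≤ 1 + ‖p.2‖ := fun p => by linarith [norm_nonneg p.2]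
  have hmono : ∀ (p : ℝ × Euc d) (r : ℝ), 0 ≤ r → r ≤ 1 + ν →
      flWeight α p * (1 + ‖p.2‖) ^ r ≤ flWeight (α + (1 + ν)) p := by
    intro p r _ hr
    rw [← flWeight_mul]
    exact mul_le_mul_of_nonneg_left (Real.rpow_le_rpow_of_exponent_le (hone p) hr)
      (flWeight_pos _ _).le
  have hYe := fun (s t : ℝ) (x : Euc d) (hs : 0 ≤ s) (hst : s ≤ t) (ht : t ≤ 1) =>
    pairBound_Yint (bhat := bhat) (r := 1 + ν) hγ (by linarith) hK hs hst ht x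
  have hmeas := fun (s t : ℝ) (x : Euc d) (hs : 0 ≤ s) (hst : s ≤ t) (ht : t ≤ 1) =>
    aestronglyMeasurable_Yint hw hs hst ht x
  refine ⟨?_, ?_, ?_, ?_⟩
  · intro s u t x hs hsu hut ht
    rw [← sub_eq_iff_eq_add, sigmaAvg_eq_pairing, sigmaAvg_eq_pairing, sigmaAvg_eq_pairing,
      (hYe s t x hs (hsu.trans hut) ht).pairing_sub (hYe u t x (hs.trans hsu) hut ht) hm hb
        (hmeas s t x hs (hsu.trans hut) ht) (hmeas u t x (hs.trans hsu) hut ht)]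
    congr 1
    ext p
    rw [Yint_add hw hs hsu hut ht]
    ring
  · intro s t x hs hst ht
    rw [sigmaAvg_eq_pairing]
    have hp : 0 ≤ (t - s) ^ κ := Real.rpow_nonneg (by linarith) _
    have hbd : PairBound bhat (α + (1 + ν)) ((K + 1) * (t - s) ^ κ)
        (fun p => Yint w s t p.1 p.2 * spaceChar x p) := by
      rcases hκ with rfl | ⟨rfl, hβ⟩
      · intro p hp'
        refine (hYe s t x hs hst ht p hp').trans ?_
        have := (flWeight_pos (α + (1 + ν)) p).le
        gcongr
        linarith
      · intro p _
        rw [norm_mul, norm_spaceChar, mul_one, Real.rpow_one]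
        refine (norm_Yint_le w hst _ _).trans ?_
        have := one_le_flWeight hβ p
        have h0 : 0 ≤ t - s := by linarith
        calc t - s = 1 * (t - s) * 1 := by ring
          _ ≤ (K + 1) * (t - s) * flWeight (α + (1 + ν)) p := by gcongr; linarith
    refine (hbd.norm_pairing_le (by positivity) hb hF).trans ?_
    have : 0 ≤ (K + 1) * F * (t - s) ^ κ := by positivity
    have hd : (0 : ℝ) ≤ d := by positivity
    nlinarith [mul_nonneg hd this]
  · intro s t x y hs hst ht
    rw [sigmaAvg_eq_pairing, sigmaAvg_eq_pairing,
      (hYe s t x hs hst ht).pairing_sub (hYe s t y hs hst ht) hm hb (hmeas s t x hs hst ht)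
        (hmeas s t y hs hst ht)]
    have hp : 0 ≤ (t - s) ^ γ := Real.rpow_nonneg (by linarith) _
    have hbd : PairBound bhat (α + (1 + ν)) (2 * (K + 1) * (t - s) ^ γ * ‖x - y‖)
        (fun p => Yint w s t p.1 p.2 * spaceChar x p - Yint w s t p.1 p.2 * spaceChar y p) := by
      intro p _
      beta_reduce
      rw [← mul_sub, norm_mul]
      have h1 := hmono p 1 (by norm_num) (by linarith)
      rw [Real.rpow_one] at h1
      have h2 := (flWeight_pos α p).le
      have h3 := (flWeight_pos (α + (1 + ν)) p).le
      calc _ ≤ (K * flWeight α p * (t - s) ^ γ) * ((1 + ‖p.2‖) * ‖x - y‖) := by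
            gcongr
            · exact norm_Yint_le_avgK hγ hK hs hst ht p
            · exact (norm_spaceChar_sub_le x y p).trans (by gcongr; linarith)
        _ = K * (t - s) ^ γ * ‖x - y‖ * (flWeight α p * (1 + ‖p.2‖)) := by ring
        _ ≤ 2 * (K + 1) * (t - s) ^ γ * ‖x - y‖ * flWeight (α + (1 + ν)) p := by
            gcongr
            linarith
    exact (hbd.norm_pairing_le (by positivity) hb hF).trans_eq (by ring)
  · intro s t x y x' y' hs hst ht
    rw [sigmaAvg_eq_pairing, sigmaAvg_eq_pairing, sigmaAvg_eq_pairing, sigmaAvg_eq_pairing,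
      (hYe s t x hs hst ht).pairing_sub (hYe s t y hs hst ht) hm hb (hmeas s t x hs hst ht)
        (hmeas s t y hs hst ht),
      (hYe s t x' hs hst ht).pairing_sub (hYe s t y' hs hst ht) hm hb (hmeas s t x' hs hst ht)
        (hmeas s t y' hs hst ht),
      ((hYe s t x hs hst ht).sub (hYe s t y hs hst ht)).pairing_sub
        ((hYe s t x' hs hst ht).sub (hYe s t y' hs hst ht)) hm hb
        ((hmeas s t x hs hst ht).sub (hmeas s t y hs hst ht))
        ((hmeas s t x' hs hst ht).sub (hmeas s t y' hs hst ht))]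
    have hp : 0 ≤ (t - s) ^ γ := Real.rpow_nonneg (by linarith) _
    set q := ‖(x - y) - (x' - y')‖ + ‖y - y'‖ ^ ν * ‖x' - y'‖ with hq
    have hq0 : 0 ≤ q := by positivity
    have hbd : PairBound bhat (α + (1 + ν)) (2 * (K + 1) * (t - s) ^ γ * q)
        (fun p => Yint w s t p.1 p.2 * spaceChar x p - Yint w s t p.1 p.2 * spaceChar y p -
          (Yint w s t p.1 p.2 * spaceChar x' p - Yint w s t p.1 p.2 * spaceChar y' p)) := by
      intro p _
      beta_reduce
      rw [← mul_sub, ← mul_sub, ← mul_sub, norm_mul]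
      have h2 := (flWeight_pos α p).le
      have h3 := (flWeight_pos (α + (1 + ν)) p).le
      calc _ ≤ (K * flWeight α p * (t - s) ^ γ) * (2 * (1 + ‖p.2‖) ^ (1 + ν) * q) := by
            gcongr
            · exact norm_Yint_le_avgK hγ hK hs hst ht p
            · exact norm_spaceChar_dbl_le hν hν1 x y x' y' p
        _ = 2 * K * (t - s) ^ γ * q * (flWeight α p * (1 + ‖p.2‖) ^ (1 + ν)) := by ring
        _ = 2 * K * (t - s) ^ γ * q * flWeight (α + (1 + ν)) p := by rw [flWeight_mul]
        _ ≤ _ := by gcongr; linarith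
    exact (hbd.norm_pairing_le (by positivity) hb hF).trans_eq (by ring)

end Driver
end Fourier

section Smooth

variable {d : ℕ}

/-- The flow of a bounded Lipschitz field is a solution in the sense of first order expansions. -/
theorem exists_isGermSol_of_field {γ B : ℝ} (hγ : 0 < γ) (hγ1 : γ ≤ 1) (hB : 0 ≤ B)
    {F : ℝ → Euc d → Euc d}
    {σ : ℝ → ℝ → Euc d → Euc d} (hF : Continuous (fun q : ℝ × Euc d => F q.1 q.2))
    (hbdd : ∀ u x, ‖F u x‖ ≤ B) (hlip : ∀ u x y, ‖F u x - F u y‖ ≤ B * ‖x - y‖)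
    (hσ : ∀ s t x i, 0 ≤ s → s ≤ t → t ≤ 1 → σ s t x i = ∫ u in s..t, F u x i) (x : Euc d) :
    ∃ θ : ℝ → Euc d, θ 0 = x ∧ IsGermSol γ σ θ := by
  lift B to ℝ≥0 using hB
  have hPL : IsPicardLindelof F (tmin := 0) (tmax := 1) ⟨0, by simp⟩ x B 0 B B := by
    refine ⟨fun t _ => ?_, fun y _ => ?_, fun t _ y _ => hbdd t y, by simp⟩
    · exact (LipschitzWith.of_dist_le_mul fun y z => by
        simpa [dist_eq_norm] using hlip t y z).lipschitzOnWith
    · exact (hF.comp (by fun_prop : Continuous fun u : ℝ => (u, y))).continuousOn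
  obtain ⟨θ, hθ0, hθ⟩ := hPL.exists_eq_forall_mem_Icc_hasDerivWithinAt₀
  refine ⟨θ, hθ0, d * (B * B), ?_⟩
  intro s t hs hst ht
  have hcont : ContinuousOn θ (Set.Icc 0 1) := fun u hu => (hθ u hu).continuousWithinAt
  have hsub : Set.Icc s t ⊆ Set.Icc 0 1 := Set.Icc_subset_Icc hs ht
  have hincr : ∀ u ∈ Set.Icc s t, ‖θ u - θ s‖ ≤ B * (t - s) := by
    intro u hu
    have := (convex_Icc (0 : ℝ) 1).norm_image_sub_le_of_norm_hasDerivWithin_le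
      (f := θ) (C := B) hθ (fun v _ => hbdd v _) (hsub ⟨le_rfl, hst⟩) (hsub hu)
    refine this.trans ?_
    rw [Real.norm_of_nonneg (by linarith [hu.1])]
    gcongr
    exact hu.2
  have hFi : ∀ i, Continuous (fun q : ℝ × Euc d => F q.1 q.2 i) := fun i => by fun_prop
  have hc1 : ∀ i, ContinuousOn (fun u => F u (θ u) i) (Set.Icc s t) := fun i =>
    (hFi i).comp_continuousOn (continuousOn_id.prodMk (hcont.mono hsub))
  have hc2 : ∀ i, Continuous (fun u => F u (θ s) i) := fun i =>
    (hFi i).comp (by fun_prop : Continuous fun u : ℝ => (u, θ s))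
  have hkey : ∀ i, |(θ t - θ s - σ s t (θ s)) i| ≤ B * B * (t - s) ^ (2 * γ) := by
    intro i
    have hintg : IntervalIntegrable (fun u => F u (θ u) i) volume s t :=
      (hc1 i).intervalIntegrable_of_Icc hst
    have hftc : ∫ u in s..t, F u (θ u) i = θ t i - θ s i := by
      refine intervalIntegral.integral_eq_sub_of_hasDerivAt_of_le hst (f := fun u => θ u i) ?_ ?_
        hintg
      · have := hcont.mono hsub
        fun_prop
      · intro u hu
        have h1 : HasDerivAt θ (F u (θ u)) u :=
          (hθ u (hsub (Set.Ioo_subset_Icc_self hu))).hasDerivAt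
            (Icc_mem_nhds (hs.trans_lt hu.1) (hu.2.trans_le ht))
        exact ((EuclideanSpace.proj i : Euc d →L[ℝ] ℝ).hasFDerivAt.comp_hasDerivAt u h1)
    rw [PiLp.sub_apply, PiLp.sub_apply, ← hftc, hσ s t _ i hs hst ht,
      ← intervalIntegral.integral_sub hintg ((hc2 i).intervalIntegrable _ _), ← Real.norm_eq_abs]
    have h0 : 0 ≤ t - s := by linarith
    refine (intervalIntegral.norm_integral_le_of_norm_le_const (C := B * (B * (t - s)))
      fun u hu => ?_).trans ?_
    · rw [Set.uIoc_of_le hst] at hu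
      rw [← PiLp.sub_apply]
      refine (PiLp.norm_apply_le _ i).trans ((hlip u _ _).trans ?_)
      gcongr
      exact hincr u (Set.Ioc_subset_Icc_self hu)
    · rw [abs_of_nonneg h0]
      have : (t - s) * (t - s) ≤ (t - s) ^ (2 * γ) := by
        rcases h0.eq_or_lt with h | h
        · rw [← h, Real.zero_rpow (by positivity)]; simp
        · rw [← sq, ← Real.rpow_two]
          exact Real.rpow_le_rpow_of_exponent_ge h (by linarith) (by linarith)
      calc (B : ℝ) * (B * (t - s)) * (t - s) = B * B * ((t - s) * (t - s)) := by ring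
        _ ≤ _ := by gcongr
  exact (norm_le_card_mul hkey).trans_eq (by ring)

/-- The space-time character along the path `w`. -/
def pathChar (w : ℝ → Euc d) (u : ℝ) (p : ℝ × Euc d) : ℂ :=
  Complex.exp (Complex.I * Complex.ofReal (inner ℝ p.2 (w u) + p.1 * u))

theorem norm_pathChar (w : ℝ → Euc d) (u : ℝ) (p : ℝ × Euc d) : ‖pathChar w u p‖ = 1 := by
  rw [pathChar, mul_comm, Complex.norm_exp_ofReal_mul_I]

/-- Fields whose Fourier transform is supported in `|ξ| ≤ R` are solved classically. -/
theorem exists_isGermSol_of_support {γ β R : ℝ} (hγ : 0 < γ) (hγ1 : γ ≤ 1) (hR : 0 ≤ R)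
    {w : ℝ → Euc d} (hw : ContinuousOn w (Set.Icc 0 1)) {bhat : ℝ × Euc d → Fin d → ℂ}
    (hm : CompMeas bhat) (hb : FLnorm d β bhat < ⊤) (hsupp : ∀ p, bhat p ≠ 0 → ‖p.2‖ ≤ R)
    (x : Euc d) :
    ∃ θ : ℝ → Euc d, θ 0 = x ∧ IsGermSol γ (sigmaAvg w bhat) θ := by
  set W := extendPath w with hW
  have hWc : Continuous W := continuous_extendPath hw
  set c : ℝ := (1 + R) ^ |β| with hc
  have hc0 : 0 ≤ c := by positivity
  have hone : ∀ p, bhat p ≠ 0 → 1 ≤ c * flWeight β p := by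
    intro p hp
    have h1 : (1 : ℝ) ≤ 1 + ‖p.2‖ := by linarith [norm_nonneg p.2]
    have h2 : (1 + ‖p.2‖) ^ (-β) ≤ c :=
      (Real.rpow_le_rpow_of_exponent_le h1 (neg_le_abs β)).trans
        (Real.rpow_le_rpow (by linarith) (by linarith [hsupp p hp]) (abs_nonneg _))
    calc (1 : ℝ) = (1 + ‖p.2‖) ^ (-β) * (1 + ‖p.2‖) ^ β := by
          rw [← Real.rpow_add (by linarith)]; simp
      _ ≤ c * (1 + ‖p.2‖) ^ β := by gcongr
      _ ≤ c * flWeight β p := by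
          unfold flWeight
          gcongr
          exact le_mul_of_one_le_right (by positivity) (one_le_logWeight _)
  set Φ : ℝ → Euc d → ℝ × Euc d → ℂ := fun u y p => pathChar W u p * spaceChar y p with hΦ
  have hΦc : Continuous (fun q : (ℝ × Euc d) × (ℝ × Euc d) => Φ q.1.1 q.1.2 q.2) := by
    simp only [hΦ, pathChar, spaceChar]
    fun_prop
  have hΦ1 : ∀ u y, PairBound bhat β c (Φ u y) := fun u y p hp => by
    simp only [hΦ, norm_mul, norm_pathChar, norm_spaceChar, mul_one]
    exact hone p hp
  have hΦm : ∀ u y, AEStronglyMeasurable (Φ u y) := fun u y =>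
    (hΦc.comp (by fun_prop : Continuous fun p : ℝ × Euc d => ((u, y), p))).aestronglyMeasurable
  set N := (FLnorm d β bhat).toReal
  have hN : 0 ≤ N := ENNReal.toReal_nonneg
  refine exists_isGermSol_of_field (F := fun u y => pairing bhat (Φ u y))
    (B := d * (c * (1 + R) * N)) hγ hγ1 (by positivity) ?_ ?_ ?_ ?_ x
  · refine (PiLp.continuous_toLp 2 _).comp (continuous_pi fun i => ?_)
    refine continuous_of_dominated (bound := fun p => c * (‖bhat p‖ * flWeight β p))
      (fun q => ((hΦ1 q.1 q.2).integrable hm hb (hΦm _ _) i).aestronglyMeasurable)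
      (fun q => Eventually.of_forall fun p => (hΦ1 q.1 q.2).norm_le i p)
      ((hm.integrable_weight hb).const_mul c) (Eventually.of_forall fun p => ?_)
    have := hΦc.comp (by fun_prop : Continuous fun q : ℝ × Euc d => (q, p))
    exact Complex.continuous_re.comp (continuous_const.mul this)
  · intro u y
    refine ((hΦ1 u y).norm_pairing_le hc0 hb le_rfl).trans ?_
    have : 0 ≤ (d : ℝ) * (c * R * N) := by positivity
    nlinarith
  · intro u y z
    rw [(hΦ1 u y).pairing_sub (hΦ1 u z) hm hb (hΦm u y) (hΦm u z)]
    have : PairBound bhat β (c * (1 + R) * ‖y - z‖) (fun p => Φ u y p - Φ u z p) := by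
      intro p hp
      simp only [hΦ]
      rw [← mul_sub, norm_mul, norm_pathChar, one_mul]
      calc _ ≤ ‖p.2‖ * ‖y - z‖ := norm_spaceChar_sub_le y z p
        _ ≤ 1 * ((1 + R) * ‖y - z‖) := by
          rw [one_mul]; gcongr; linarith [hsupp p hp]
        _ ≤ c * flWeight β p * ((1 + R) * ‖y - z‖) := by gcongr; exact hone p hp
        _ = _ := by ring
    exact (this.norm_pairing_le (by positivity) hb le_rfl).trans_eq (by ring)
  · intro s t y i hs hst ht
    have hintg : Integrable (Function.uncurry fun (u : ℝ) (p : ℝ × Euc d) => (bhat p i * Φ u y p).re)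
        ((volume.restrict (Set.uIoc s t)).prod volume) := by
      have hfin : IsFiniteMeasure ((volume : Measure ℝ).restrict (Set.uIoc s t)) := by
        rw [Set.uIoc]; infer_instance
      refine (((hm.integrable_weight hb).const_mul c).comp_snd _).mono' ?_
        (Eventually.of_forall fun q => (hΦ1 q.1 y).norm_le i q.2)
      refine Complex.continuous_re.comp_aestronglyMeasurable (((hm i).comp_snd).mul ?_)
      exact (hΦc.comp (by fun_prop :
        Continuous fun q : ℝ × (ℝ × Euc d) => ((q.1, y), q.2))).aestronglyMeasurable
    simp only [pairing_apply]
    rw [intervalIntegral_integral_swap hintg, sigmaAvg_eq_pairing, pairing_apply]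
    congr 1
    ext p
    have hii : IntervalIntegrable (fun u => bhat p i * Φ u y p) volume s t :=
      Continuous.intervalIntegrable (continuous_const.mul (hΦc.comp (by fun_prop :
        Continuous fun u : ℝ => ((u, y), p)))) _ _
    have := Complex.reCLM.intervalIntegral_comp_comm hii
    simp only [Complex.reCLM_apply] at this
    rw [this, intervalIntegral.integral_const_mul]
    simp only [hΦ, intervalIntegral.integral_mul_const]
    rw [← Yint_extendPath w hs hst ht]
    rfl

end Smooth

section Approximation

variable {d : ℕ}

theorem FLnorm_mono (β : ℝ) {bhat bhat' : ℝ × Euc d → Fin d → ℂ} (h : ∀ p, ‖bhat p‖ ≤ ‖bhat' p‖) :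
    FLnorm d β bhat ≤ FLnorm d β bhat' := by
  rw [FLnorm_eq, FLnorm_eq]
  refine lintegral_mono fun p => ENNReal.ofReal_le_ofReal ?_
  exact mul_le_mul_of_nonneg_right (h p) (flWeight_pos β p).le

/-- Restriction of a Fourier transform to the frequencies `|ξ| ≤ n`. -/
def freqCutoff (bhat : ℝ × Euc d → Fin d → ℂ) (n : ℕ) : ℝ × Euc d → Fin d → ℂ :=
  {p : ℝ × Euc d | ‖p.2‖ ≤ n}.indicator bhat

theorem measurableSet_norm_snd_le (n : ℕ) : MeasurableSet {p : ℝ × Euc d | ‖p.2‖ ≤ n} :=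
  measurableSet_le (by fun_prop) (by fun_prop)

theorem CompMeas.freqCutoff {bhat : ℝ × Euc d → Fin d → ℂ} (hm : CompMeas bhat) (n : ℕ) :
    CompMeas (freqCutoff bhat n) := by
  intro i
  refine ((hm i).indicator (measurableSet_norm_snd_le n)).congr (Eventually.of_forall fun p => ?_)
  by_cases hp : p ∈ {p : ℝ × Euc d | ‖p.2‖ ≤ n} <;> simp [_root_.freqCutoff, hp]

theorem norm_freqCutoff_le (bhat : ℝ × Euc d → Fin d → ℂ) (n : ℕ) (p : ℝ × Euc d) :
    ‖freqCutoff bhat n p‖ ≤ ‖bhat p‖ :=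
  norm_indicator_le_norm_self _ _

theorem norm_freqCutoff_sub_le (bhat : ℝ × Euc d → Fin d → ℂ) (n : ℕ) (p : ℝ × Euc d) :
    ‖(freqCutoff bhat n - bhat) p‖ ≤ ‖bhat p‖ := by
  by_cases hp : p ∈ {p : ℝ × Euc d | ‖p.2‖ ≤ n} <;> simp [freqCutoff, hp]

theorem CompMeas.sub {bhat bhat' : ℝ × Euc d → Fin d → ℂ} (hm : CompMeas bhat)
    (hm' : CompMeas bhat') : CompMeas (bhat - bhat') := fun i => (hm i).sub (hm' i)

theorem tendsto_FLnorm_freqCutoff {β : ℝ} {bhat : ℝ × Euc d → Fin d → ℂ} (hm : CompMeas bhat)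
    (hb : FLnorm d β bhat < ⊤) :
    Tendsto (fun n => FLnorm d β (freqCutoff bhat n - bhat)) atTop (𝓝 0) := by
  simp only [FLnorm_eq] at hb ⊢
  have := tendsto_lintegral_of_dominated_convergence' (μ := (volume : Measure (ℝ × Euc d)))
    (F := fun n p => ENNReal.ofReal (‖(freqCutoff bhat n - bhat) p‖ * flWeight β p)) (f := 0)
    (fun p => ENNReal.ofReal (‖bhat p‖ * flWeight β p)) (fun n => ?_)
    (fun n => Eventually.of_forall fun p => ENNReal.ofReal_le_ofReal ?_) hb.ne
    (Eventually.of_forall fun p => ?_)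
  · simpa using this
  · exact (((hm.freqCutoff n).sub hm).aestronglyMeasurable.norm.mul
      (measurable_flWeight β).aestronglyMeasurable).aemeasurable.ennreal_ofReal
  · exact mul_le_mul_of_nonneg_right (norm_freqCutoff_sub_le bhat n p) (flWeight_pos β p).le
  · refine tendsto_const_nhds.congr' ?_
    obtain ⟨N, hN⟩ := exists_nat_ge ‖p.2‖
    filter_upwards [eventually_ge_atTop N] with n hn
    have : ‖p.2‖ ≤ n := hN.trans (by exact_mod_cast hn)
    simp [freqCutoff, this]

/-- Solutions exist for Fourier transforms with measurable components. -/
theorem exists_isGermSol_sigmaAvg {α γ κ ν : ℝ} {w : ℝ → Euc d} {bhat : ℝ × Euc d → Fin d → ℂ}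
    (he : Exponents γ κ ν) (hν1 : ν ≤ 1)
    (hκ : κ = γ ∨ (κ = 1 ∧ 0 ≤ α + (1 + ν)))
    (hw : ContinuousOn w (Set.Icc 0 1)) (hK : avgK w α γ < ⊤) (hm : CompMeas bhat)
    (hb : FLnorm d (α + (1 + ν)) bhat < ⊤) (x : Euc d) :
    ∃ θ : ℝ → Euc d, θ 0 = x ∧ IsGermSol γ (sigmaAvg w bhat) θ := by
  have hγ : 0 < γ := by linarith [he.half_lt]
  have hγ1 : γ ≤ 1 := he.le.trans he.le_one
  have hν := he.nonneg
  have hcut : ∀ n, FLnorm d (α + (1 + ν)) (freqCutoff bhat n) ≤ FLnorm d (α + (1 + ν)) bhat :=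
    fun n => FLnorm_mono _ (norm_freqCutoff_le bhat n)
  have hcut' : ∀ n, FLnorm d (α + (1 + ν)) (freqCutoff bhat n - bhat) < ⊤ :=
    fun n => (FLnorm_mono _ (norm_freqCutoff_sub_le bhat n)).trans_lt hb
  set ε : ℕ → ℝ := fun n => d * (2 * ((avgK w α γ).toReal + 1) *
    (FLnorm d (α + (1 + ν)) (freqCutoff bhat n - bhat)).toReal) with hε
  have hε0 : ∀ n, 0 ≤ ε n := fun n => by positivity
  have hsub : ∀ n s t y, 0 ≤ s → s ≤ t → t ≤ 1 →
      sigmaAvg w (freqCutoff bhat n) s t y - sigmaAvg w bhat s t y =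
        sigmaAvg w (freqCutoff bhat n - bhat) s t y := by
    intro n s t y hs hst ht
    simp only [sigmaAvg_eq_pairing]
    exact pairing_sub_left (pairBound_Yint hγ (by linarith) hK hs hst ht y)
      (pairBound_Yint hγ (by linarith) hK hs hst ht y) (hm.freqCutoff n) hm
      ((hcut n).trans_lt hb) hb (aestronglyMeasurable_Yint hw hs hst ht y)
  choose θ h0 hsol using fun n : ℕ => exists_isGermSol_of_support (γ := γ) hγ hγ1 n.cast_nonneg hw
    (hm.freqCutoff n) ((hcut n).trans_lt hb) (R := n) (fun p hp => by
      by_contra h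
      exact hp (Set.indicator_of_notMem (by simpa using h) _)) x
  refine IsDriver.exists_germSol
    (M := d * (2 * ((avgK w α γ).toReal + 1) * (FLnorm d (α + (1 + ν)) bhat).toReal))
    (by positivity) he (isDriver_sigmaAvg he hν1 hκ hw hK hm hb le_rfl)
    (fun n => isDriver_sigmaAvg he hν1 hκ hw hK (hm.freqCutoff n) ((hcut n).trans_lt hb)
      (ENNReal.toReal_mono hb.ne (hcut n))) hε0 ?_ (fun n => ?_) x h0 hsol
  · have := (ENNReal.tendsto_toReal ENNReal.zero_ne_top).comp (tendsto_FLnorm_freqCutoff hm hb)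
    have := (this.const_mul (2 * ((avgK w α γ).toReal + 1))).const_mul (d : ℝ)
    simpa using this
  · have hdr := isDriver_sigmaAvg he hν1 hκ hw hK ((hm.freqCutoff n).sub hm) (hcut' n) le_rfl
    refine ⟨fun s t y hs hst ht => ?_, fun s t y z hs hst ht => ?_⟩
    · rw [hsub n s t y hs hst ht]
      refine (hdr.bdd s t y hs hst ht).trans ?_
      have hle : (t - s) ^ κ ≤ (t - s) ^ γ :=
        Real.rpow_le_rpow_of_exponent_ge_of_imp (by linarith) (by linarith) he.le
          fun _ h => absurd h (hγ.trans_le he.le).ne'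
      exact mul_le_mul_of_nonneg_left hle (hε0 n)
    · rw [hsub n s t y hs hst ht, hsub n s t z hs hst ht]
      exact hdr.lip s t y z hs hst ht

end Approximation

section Analytic

open ProbabilityTheory

/-- The zero set of a real analytic function that is not identically zero is null. -/
theorem ae_ne_zero_of_analyticOnNhd {f : ℝ → ℝ} (hf : AnalyticOnNhd ℝ f Set.univ) {r₀ : ℝ}
    (h0 : f r₀ ≠ 0) : ∀ᵐ r, f r ≠ 0 := by
  have h1 := hf.preimage_zero_mem_codiscrete h0
  have h2 := ae_restrict_le_codiscreteWithin (U := (Set.univ : Set ℝ)) (μ := volume)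
    MeasurableSet.univ
  rw [Measure.restrict_univ] at h2
  exact h2 h1

/-- If `∫ X ≠ 0` then `∫ sin (r X)` vanishes only for a null set of `r`. -/
theorem ae_integral_sin_ne_zero {Ω : Type*} [MeasurableSpace Ω] {μ : Measure Ω} {X : Ω → ℝ}
    (hX : ∀ r : ℝ, Integrable (fun o => Real.exp (r * X o)) μ) (h : ∫ o, X o ∂μ ≠ 0) :
    ∀ᵐ r : ℝ, (∫ o, Complex.exp (Complex.I * Complex.ofReal (r * X o)) ∂μ).im ≠ 0 := by
  have huniv : integrableExpSet X μ = Set.univ := Set.eq_univ_of_forall hX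
  have hintg : ∀ z : ℂ, z.re ∈ interior (integrableExpSet X μ) := by simp [huniv]
  have heq : ∀ r : ℝ, ∫ o, Complex.exp (Complex.I * Complex.ofReal (r * X o)) ∂μ =
      complexMGF X μ (Complex.I * r) := by
    intro r
    simp only [complexMGF, Complex.ofReal_mul, mul_assoc]
  have han : AnalyticOnNhd ℝ (fun r : ℝ => (complexMGF X μ (Complex.I * r)).im) Set.univ := by
    intro r _
    refine AnalyticAt.im_ofReal (f := fun z => complexMGF X μ (Complex.I * z)) ?_
    exact (analyticAt_complexMGF (hintg _)).comp (by fun_prop)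
  have hder : HasDerivAt (fun r : ℝ => (complexMGF X μ (Complex.I * r)).im) (∫ o, X o ∂μ) 0 := by
    have h1 : HasDerivAt (fun z : ℂ => complexMGF X μ (Complex.I * z))
        ((∫ o, X o * Complex.exp (Complex.I * (0 : ℝ) * X o) ∂μ) * Complex.I) ((0 : ℝ) : ℂ) := by
      refine HasDerivAt.comp (h₂ := complexMGF X μ) _ (hasDerivAt_complexMGF (hintg _)) ?_
      simpa using (hasDerivAt_id ((0 : ℝ) : ℂ)).const_mul Complex.I
    have h2 := h1.comp_ofReal
    have h3 := Complex.imCLM.hasFDerivAt.comp_hasDerivAt _ h2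
    refine h3.congr_deriv ?_
    simp [integral_complex_ofReal]
  obtain ⟨r₀, hr₀⟩ : ∃ r₀ : ℝ, (complexMGF X μ (Complex.I * r₀)).im ≠ 0 := by
    by_contra! hall
    refine h (hder.unique ?_)
    rw [funext hall]
    exact hasDerivAt_const _ _
  simpa only [heq] using ae_ne_zero_of_analyticOnNhd han hr₀

/-- A closed set meeting almost every line through the origin in a null set is null. -/
theorem ae_of_ae_smul {V : Type*} [NormedAddCommGroup V] [NormedSpace ℝ V] [MeasurableSpace V]
    [BorelSpace V] [FiniteDimensional ℝ V] (μ : Measure V) [μ.IsAddHaarMeasure] {U : Set V}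
    (hU : IsOpen U) (h : ∀ᵐ q ∂μ, ∀ᵐ r : ℝ, r • q ∈ U) : ∀ᵐ q ∂μ, q ∈ U := by
  have hmeas : MeasurableSet {z : V × ℝ | z.2 • z.1 ∈ U} :=
    (hU.preimage (by fun_prop : Continuous fun z : V × ℝ => z.2 • z.1)).measurableSet
  have h1 : ∀ᵐ r : ℝ, ∀ᵐ q ∂μ, r • q ∈ U := (Measure.ae_ae_comm hmeas).1 h
  have h2 : ∀ᵐ r : ℝ, r ≠ 0 := by simp [ae_iff]
  obtain ⟨r, hr, hr0⟩ := (h1.and h2).exists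
  rw [ae_iff] at hr ⊢
  have h3 := Measure.addHaar_preimage_smul μ hr0 {q | q ∉ U}
  have h4 : (r • ·) ⁻¹' {q : V | q ∉ U} = {q | ¬ r • q ∈ U} := rfl
  rw [h4, hr, eq_comm, mul_eq_zero] at h3
  refine h3.resolve_left ?_
  simp [hr0]

end Analytic

section Midpoint

variable {d : ℕ}

theorem Yint_mul_spaceChar {w : ℝ → Euc d} {s t : ℝ} (hst : s ≤ t) (x : Euc d) (p : ℝ × Euc d) :
    Yint w s t p.1 p.2 * spaceChar x p =
      ∫ u in Set.Icc s t, Complex.exp (Complex.I * Complex.ofReal (inner ℝ p.2 (w u + x) + p.1 * u)) := by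
  rw [Yint, ← intervalIntegral.integral_mul_const, intervalIntegral.integral_of_le hst,
    integral_Icc_eq_integral_Ioc]
  refine integral_congr_ae (Eventually.of_forall fun u => ?_)
  simp only [spaceChar, ← Complex.exp_add, inner_add_right]
  push_cast
  ring_nf

theorem conj_exp_I_mul_ofReal (a : ℝ) :
    (starRingEnd ℂ) (Complex.exp (Complex.I * a)) = Complex.exp (Complex.I * ((-a : ℝ) : ℂ)) := by
  rw [← Complex.exp_conj]
  simp

instance isAddHaarMeasure_volume_prod : (volume : Measure (ℝ × Euc d)).IsAddHaarMeasure :=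
  Measure.prod.instIsAddHaarMeasure volume volume

/-- The difference of the phases of the two integrals `Y` at times `z.1` and `z.2`. -/
def phaseDiff (w : ℝ → Euc d) (x x' : Euc d) (p : ℝ × Euc d) (z : ℝ × ℝ) : ℝ :=
  inner ℝ p.2 (w z.1 + x - (w z.2 + x')) + p.1 * (z.1 - z.2)

theorem phaseDiff_add (w : ℝ → Euc d) (x x' : Euc d) (p q : ℝ × Euc d) (z : ℝ × ℝ) :
    phaseDiff w x x' (p + q) z = phaseDiff w x x' p z + phaseDiff w x x' q z := by
  simp only [phaseDiff, Prod.fst_add, Prod.snd_add, inner_add_left]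
  ring

theorem phaseDiff_smul (w : ℝ → Euc d) (x x' : Euc d) (r : ℝ) (p : ℝ × Euc d) (z : ℝ × ℝ) :
    phaseDiff w x x' (r • p) z = r * phaseDiff w x x' p z := by
  simp only [phaseDiff, Prod.smul_fst, Prod.smul_snd, real_inner_smul_left, smul_eq_mul]
  ring

theorem continuous_phaseDiff_uncurry {w : ℝ → Euc d} (hw : Continuous w) (x x' : Euc d) :
    Continuous (fun y : (ℝ × Euc d) × (ℝ × ℝ) => phaseDiff w x x' y.1 y.2) := by
  unfold phaseDiff
  fun_prop

theorem continuous_phaseDiff {w : ℝ → Euc d} (hw : Continuous w) (x x' : Euc d)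
    (p : ℝ × Euc d) : Continuous (phaseDiff w x x' p) := by
  unfold phaseDiff
  fun_prop

theorem Yint_mul_conj_eq_integral {w : ℝ → Euc d} {s t s' t' : ℝ} (hst : s ≤ t) (hst' : s' ≤ t')
    (x x' : Euc d) (p : ℝ × Euc d) :
    Yint w s t p.1 p.2 * spaceChar x p *
      (starRingEnd ℂ) (Yint w s' t' p.1 p.2 * spaceChar x' p) =
        ∫ z in Set.Icc s t ×ˢ Set.Icc s' t',
          Complex.exp (Complex.I * Complex.ofReal (phaseDiff w x x' p z)) := by
  rw [Yint_mul_spaceChar hst, Yint_mul_spaceChar hst', ← integral_conj,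
    Measure.volume_eq_prod, ← setIntegral_prod_mul]
  refine integral_congr_ae (Eventually.of_forall fun z => ?_)
  simp only [conj_exp_I_mul_ofReal, ← Complex.exp_add, phaseDiff, inner_sub_right]
  push_cast
  ring_nf

theorem setIntegral_fst_sub_snd_ne_zero {s t s' t' : ℝ} (hst : s < t)
    (hst' : s' < t') (hmid : s + t ≠ s' + t') :
    ∫ z in Set.Icc s t ×ˢ Set.Icc s' t', (z.1 - z.2) ≠ 0 := by
  have hQc : IsCompact (Set.Icc s t ×ˢ Set.Icc s' t') := isCompact_Icc.prod isCompact_Icc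
  have hid : ∀ a b : ℝ, a < b → ∫ u in Set.Icc a b, u = (b ^ 2 - a ^ 2) / 2 := fun a b hab => by
    rw [integral_Icc_eq_integral_Ioc, ← intervalIntegral.integral_of_le hab.le, integral_id]
  have hone : ∀ a b : ℝ, a < b → ∫ u in Set.Icc a b, (1 : ℝ) = b - a := fun a b hab => by
    simp [hab.le]
  have e1 : ∫ z in Set.Icc s t ×ˢ Set.Icc s' t', (z.1 - z.2) =
      (∫ z in Set.Icc s t ×ˢ Set.Icc s' t', z.1 * 1) -
        ∫ z in Set.Icc s t ×ˢ Set.Icc s' t', 1 * z.2 := by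
    rw [← integral_sub
      ((by fun_prop : Continuous fun z : ℝ × ℝ => z.1 * 1).continuousOn.integrableOn_compact hQc)
      ((by fun_prop : Continuous fun z : ℝ × ℝ => 1 * z.2).continuousOn.integrableOn_compact hQc)]
    simp only [mul_one, one_mul]
  rw [e1, Measure.volume_eq_prod, setIntegral_prod_mul (fun u : ℝ => u) (fun _ : ℝ => (1 : ℝ)),
    setIntegral_prod_mul (fun _ : ℝ => (1 : ℝ)) (fun u : ℝ => u), hid _ _ hst, hid _ _ hst',
    hone _ _ hst, hone _ _ hst']
  have : (t ^ 2 - s ^ 2) / 2 * (t' - s') - (t - s) * ((t' ^ 2 - s' ^ 2) / 2) =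
      (t - s) * (t' - s') * ((s + t) - (s' + t')) / 2 := by ring
  rw [this]
  exact div_ne_zero (mul_ne_zero (mul_ne_zero (sub_pos.2 hst).ne' (sub_pos.2 hst').ne')
    (sub_ne_zero.2 hmid)) two_ne_zero

theorem ae_setIntegral_phaseDiff_ne_zero {w : ℝ → Euc d} (hw : Continuous w) {s t s' t' : ℝ}
    (hst : s < t) (hst' : s' < t') (hmid : s + t ≠ s' + t') (x x' : Euc d) :
    ∀ᵐ p : ℝ × Euc d, ∫ z in Set.Icc s t ×ˢ Set.Icc s' t', phaseDiff w x x' p z ≠ 0 := by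
  have hQc : IsCompact (Set.Icc s t ×ˢ Set.Icc s' t') := isCompact_Icc.prod isCompact_Icc
  have hXi : ∀ p, IntegrableOn (phaseDiff w x x' p) (Set.Icc s t ×ˢ Set.Icc s' t') := fun p =>
    (continuous_phaseDiff hw x x' p).continuousOn.integrableOn_compact hQc
  let Lin : (ℝ × Euc d) →ₗ[ℝ] ℝ :=
    { toFun := fun p => ∫ z in Set.Icc s t ×ˢ Set.Icc s' t', phaseDiff w x x' p z
      map_add' := fun p q => by
        rw [← integral_add (hXi p) (hXi q)]
        simp only [phaseDiff_add]
      map_smul' := fun r p => by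
        rw [RingHom.id_apply, smul_eq_mul, ← integral_const_mul]
        simp only [phaseDiff_smul] }
  have hL1 : Lin (1, 0) ≠ 0 := by
    have := setIntegral_fst_sub_snd_ne_zero hst hst' hmid
    simpa only [Lin, LinearMap.coe_mk, AddHom.coe_mk, phaseDiff, inner_zero_left, zero_add, one_mul]
      using this
  have hnull : volume ((LinearMap.ker Lin : Submodule ℝ (ℝ × Euc d)) : Set (ℝ × Euc d)) = 0 := by
    refine Measure.addHaar_submodule _ _ fun h => hL1 ?_
    rw [LinearMap.ker_eq_top] at h
    rw [h, LinearMap.zero_apply]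
  exact (measure_eq_zero_iff_ae_notMem.1 hnull).mono fun p hp h => hp h

theorem continuous_setIntegral_exp_phaseDiff {w : ℝ → Euc d} (hw : Continuous w) {Q : Set (ℝ × ℝ)}
    (hQ : IsCompact Q) (x x' : Euc d) :
    Continuous fun p : ℝ × Euc d =>
      ∫ z in Q, Complex.exp (Complex.I * Complex.ofReal (phaseDiff w x x' p z)) := by
  refine continuous_of_dominated (bound := fun _ => 1)
    (fun p => ?_) (fun p => Eventually.of_forall fun z => ?_) ?_
    (Eventually.of_forall fun z => ?_)
  · have := continuous_phaseDiff hw x x' p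
    exact Continuous.aestronglyMeasurable (by fun_prop)
  · rw [mul_comm, Complex.norm_exp_ofReal_mul_I]
  · exact continuous_const.continuousOn.integrableOn_compact hQ
  · have := (continuous_phaseDiff_uncurry hw x x').comp
      (by fun_prop : Continuous fun p : ℝ × Euc d => (p, z))
    simp only [Function.comp_def] at this
    fun_prop

theorem ae_im_mul_conj_ne_zero {w : ℝ → Euc d} (hw : Continuous w) {s t s' t' : ℝ} (hst : s < t)
    (hst' : s' < t') (hmid : s + t ≠ s' + t') (x x' : Euc d) :
    ∀ᵐ p : ℝ × Euc d, (Yint w s t p.1 p.2 * spaceChar x p *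
      (starRingEnd ℂ) (Yint w s' t' p.1 p.2 * spaceChar x' p)).im ≠ 0 := by
  have hQc : IsCompact (Set.Icc s t ×ˢ Set.Icc s' t') := isCompact_Icc.prod isCompact_Icc
  have hcont := Complex.continuous_im.comp (continuous_setIntegral_exp_phaseDiff hw hQc x x')
  simp only [Yint_mul_conj_eq_integral hst.le hst'.le]
  refine ae_of_ae_smul volume (isOpen_ne_fun hcont continuous_const) ?_
  filter_upwards [ae_setIntegral_phaseDiff_ne_zero hw hst hst' hmid x x'] with p hp
  have := ae_integral_sin_ne_zero (fun r => by
    have := continuous_phaseDiff hw x x' p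
    exact (by fun_prop : Continuous fun z =>
      Real.exp (r * phaseDiff w x x' p z)).continuousOn.integrableOn_compact hQc) hp
  filter_upwards [this] with r hr
  change (∫ z in Set.Icc s t ×ˢ Set.Icc s' t',
    Complex.exp (Complex.I * Complex.ofReal (phaseDiff w x x' (r • p) z))).im ≠ 0
  simpa only [phaseDiff_smul] using hr

end Midpoint

section MeasurablePart

variable {d : ℕ}

/-- A complex function is measurable if its real parts after multiplication by two measurable
functions of different argument are. -/
theorem aestronglyMeasurable_of_re_mul {V : Type*} [MeasurableSpace V] {μ : Measure V}
    {c g h : V → ℂ} (hg : AEStronglyMeasurable g μ) (hh : AEStronglyMeasurable h μ)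
    (hne : ∀ᵐ p ∂μ, (g p * (starRingEnd ℂ) (h p)).im ≠ 0)
    (hA : AEStronglyMeasurable (fun p => (c p * g p).re) μ)
    (hB : AEStronglyMeasurable (fun p => (c p * h p).re) μ) : AEStronglyMeasurable c μ := by
  have hg' := Complex.continuous_conj.comp_aestronglyMeasurable hg
  have hh' := Complex.continuous_conj.comp_aestronglyMeasurable hh
  have hA' := Complex.continuous_ofReal.comp_aestronglyMeasurable hA
  have hB' := Complex.continuous_ofReal.comp_aestronglyMeasurable hB
  have hD := Complex.continuous_ofReal.comp_aestronglyMeasurable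
    (Complex.continuous_im.comp_aestronglyMeasurable (hg.mul hh'))
  refine (((hA'.mul hh').sub (hB'.mul hg')).aemeasurable.div
    (hD.aemeasurable.mul_const Complex.I)).aestronglyMeasurable.congr ?_
  filter_upwards [hne] with p hp
  simp only [Pi.div_apply, Pi.sub_apply, Pi.mul_apply]
  rw [div_eq_iff (mul_ne_zero (by exact_mod_cast hp) Complex.I_ne_zero)]
  apply Complex.ext <;> simp <;> ring

theorem aestronglyMeasurable_of_sigmaAvg_ne_zero {w : ℝ → Euc d}
    (hw : ContinuousOn w (Set.Icc 0 1)) {bhat : ℝ × Euc d → Fin d → ℂ} {i : Fin d}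
    {s t s' t' : ℝ} (hs : 0 ≤ s) (hst : s < t) (ht : t ≤ 1) (hs' : 0 ≤ s') (hst' : s' < t')
    (ht' : t' ≤ 1) (hmid : s + t ≠ s' + t') {x x' : Euc d} (h : sigmaAvg w bhat s t x i ≠ 0)
    (h' : sigmaAvg w bhat s' t' x' i ≠ 0) :
    AEStronglyMeasurable (fun p => bhat p i) := by
  rw [sigmaAvg_eq_pairing, pairing_apply] at h h'
  refine aestronglyMeasurable_of_re_mul (aestronglyMeasurable_Yint hw hs hst.le ht x)
    (aestronglyMeasurable_Yint hw hs' hst'.le ht' x') ?_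
    (not_imp_comm.1 integral_undef h).aestronglyMeasurable
    (not_imp_comm.1 integral_undef h').aestronglyMeasurable
  have := ae_im_mul_conj_ne_zero (continuous_extendPath hw) hst hst' hmid x x'
  simpa only [Yint_extendPath w hs hst.le ht, Yint_extendPath w hs' hst'.le ht'] using this

open Classical in
/-- The Fourier transform with its non-measurable components replaced by zero. -/
def measPart (bhat : ℝ × Euc d → Fin d → ℂ) : ℝ × Euc d → Fin d → ℂ := fun p i =>
  if AEStronglyMeasurable (fun q => bhat q i) (volume : Measure (ℝ × Euc d)) then bhat p i else 0

theorem compMeas_measPart (bhat : ℝ × Euc d → Fin d → ℂ) : CompMeas (measPart bhat) := by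
  intro i
  by_cases h : AEStronglyMeasurable (fun q => bhat q i) (volume : Measure (ℝ × Euc d))
  · simpa only [measPart, if_pos h] using h
  · simpa only [measPart, if_neg h] using aestronglyMeasurable_const

theorem norm_measPart_le (bhat : ℝ × Euc d → Fin d → ℂ) (p : ℝ × Euc d) :
    ‖measPart bhat p‖ ≤ ‖bhat p‖ := by
  refine (pi_norm_le_iff_of_nonneg (norm_nonneg _)).2 fun i => ?_
  unfold measPart
  split_ifs
  · exact norm_le_pi_norm _ i
  · simp

theorem sigmaAvg_self (w : ℝ → Euc d) (bhat : ℝ × Euc d → Fin d → ℂ) (s : ℝ) (x : Euc d)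
    (i : Fin d) : sigmaAvg w bhat s s x i = 0 := by
  rw [sigmaAvg_eq_pairing, pairing_apply]
  simp [Yint]

/-- Two nondegenerate intervals of a partition have different midpoints. -/
theorem TimePartition.eq_of_midpoint_eq {s t : ℝ} (P : TimePartition s t) {j k : ℕ} (hj : j < P.n)
    (hk : k < P.n) (hj' : P.pts j < P.pts (j + 1)) (hk' : P.pts k < P.pts (k + 1))
    (h : P.pts j + P.pts (j + 1) = P.pts k + P.pts (k + 1)) : j = k := by
  rcases lt_trichotomy j k with hlt | rfl | hlt
  · have := P.pts_mono (show j + 1 ≤ k from hlt) hk.le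
    linarith
  · rfl
  · have := P.pts_mono (show k + 1 ≤ j from hlt) hj.le
    linarith

/-- The non-measurable components contribute at most one term to a Riemann sum. -/
theorem norm_youngSum_measPart_sub_le {α γ r : ℝ} (hγ : 0 < γ) (hr : 0 ≤ r) {w : ℝ → Euc d}
    (hw : ContinuousOn w (Set.Icc 0 1)) (hK : avgK w α γ < ⊤) {bhat : ℝ × Euc d → Fin d → ℂ}
    (hb : FLnorm d (α + r) bhat < ⊤) (θ : ℝ → Euc d) {s t δ : ℝ} (hs : 0 ≤ s) (ht : t ≤ 1)
    (hδ : 0 < δ) (P : TimePartition s t) (hP : P.MeshLt δ) :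
    ‖youngSum (sigmaAvg w bhat) θ P - youngSum (sigmaAvg w (measPart bhat)) θ P‖ ≤
      d * ((avgK w α γ).toReal * (FLnorm d (α + r) bhat).toReal) * δ ^ γ := by
  rw [mul_assoc]
  refine norm_le_card_mul fun i => ?_
  have hcomp : ∀ b : ℝ × Euc d → Fin d → ℂ, youngSum (sigmaAvg w b) θ P i =
      ∑ k ∈ Finset.range P.n, sigmaAvg w b (P.pts k) (P.pts (k + 1)) (θ (P.pts k)) i := by
    intro b
    simp [youngSum]
  have hbound : 0 ≤ (avgK w α γ).toReal * (FLnorm d (α + r) bhat).toReal * δ ^ γ := by positivity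
  rw [PiLp.sub_apply, hcomp, hcomp, ← Finset.sum_sub_distrib]
  by_cases hmeas : AEStronglyMeasurable (fun q => bhat q i) (volume : Measure (ℝ × Euc d))
  · rw [Finset.sum_eq_zero fun k _ => ?_]
    · simpa using hbound
    · simp only [sigmaAvg_eq_pairing, pairing_apply, measPart, if_pos hmeas, sub_self]
  have hzero : ∀ s t x, sigmaAvg w (measPart bhat) s t x i = 0 := fun s t x => by
    simp [sigmaAvg_eq_pairing, pairing_apply, measPart, if_neg hmeas]
  simp only [hzero, sub_zero]
  by_cases hex : ∃ k ∈ Finset.range P.n,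
      sigmaAvg w bhat (P.pts k) (P.pts (k + 1)) (θ (P.pts k)) i ≠ 0
  swap
  · push Not at hex
    rw [Finset.sum_eq_zero hex]
    simpa using hbound
  have hlt : ∀ k, k < P.n → sigmaAvg w bhat (P.pts k) (P.pts (k + 1)) (θ (P.pts k)) i ≠ 0 →
      P.pts k < P.pts (k + 1) := fun k hk hne =>
    lt_of_le_of_ne (P.mono k hk) fun he => hne (by rw [← he]; exact sigmaAvg_self w bhat _ _ i)
  have h0 : ∀ k, k ≤ P.n → 0 ≤ P.pts k := fun k hk => hs.trans (P.le_pts hk)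
  have h1 : ∀ k, k ≤ P.n → P.pts k ≤ 1 := fun k hk => (P.pts_le hk).trans ht
  obtain ⟨k, hkm, hk⟩ := hex
  have hkn := Finset.mem_range.1 hkm
  rw [Finset.sum_eq_single_of_mem k hkm fun j hjm hjk => ?_]
  · rw [sigmaAvg_eq_pairing]
    have hle := P.mono k hkn
    refine ((pairBound_Yint hγ hr hK (h0 k hkn.le) hle (h1 (k + 1) hkn) _).abs_pairing_le
      (mul_nonneg ENNReal.toReal_nonneg (Real.rpow_nonneg (by linarith) _)) hb i).trans ?_
    have : (P.pts (k + 1) - P.pts k) ^ γ ≤ δ ^ γ :=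
      Real.rpow_le_rpow (by linarith) (hP k hkn).le hγ.le
    calc _ = (avgK w α γ).toReal * (FLnorm d (α + r) bhat).toReal *
          (P.pts (k + 1) - P.pts k) ^ γ := by ring
      _ ≤ _ := by gcongr
  · by_contra hj
    have hjn := Finset.mem_range.1 hjm
    refine hmeas (aestronglyMeasurable_of_sigmaAvg_ne_zero hw (h0 j hjn.le) (hlt j hjn hj)
      (h1 (j + 1) hjn) (h0 k hkn.le) (hlt k hkn hk) (h1 (k + 1) hkn) (fun h => hjk ?_) hj hk)
    exact P.eq_of_midpoint_eq hjn hkn (hlt j hjn hj) (hlt k hkn hk) h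

end MeasurablePart

section Main

variable {d : ℕ} {α γ κ ν : ℝ} {w : ℝ → Euc d} {bhat : ℝ × Euc d → Fin d → ℂ}

/-- Solutions of the Young equation are the solutions in the sense of first order expansions for
the measurable part of the field. -/
theorem solvesSigmaYoung_iff (he : Exponents γ κ ν) (hν1 : ν ≤ 1)
    (hκ : κ = γ ∨ (κ = 1 ∧ 0 ≤ α + (1 + ν)))
    (hw : ContinuousOn w (Set.Icc 0 1)) (hK : avgK w α γ < ⊤)
    (hb : FLnorm d (α + (1 + ν)) bhat < ⊤) {x : Euc d} {θ : ℝ → Euc d} (hθ : HolderOnIcc γ θ) :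
    SolvesSigmaYoung w bhat x θ ↔ θ 0 = x ∧ IsGermSol γ (sigmaAvg w (measPart bhat)) θ := by
  have hγ : 0 < γ := by linarith [he.half_lt]
  have hν := he.nonneg
  have hb' : FLnorm d (α + (1 + ν)) (measPart bhat) < ⊤ :=
    (FLnorm_mono _ (norm_measPart_le bhat)).trans_lt hb
  have hdr := isDriver_sigmaAvg he hν1 hκ hw hK (compMeas_measPart bhat) hb' le_rfl
  have hsub := fun (t : ℝ) (ht : t ≤ 1) (P : TimePartition 0 t) (δ : ℝ) (hδ : 0 < δ)
    (hP : P.MeshLt δ) => norm_youngSum_measPart_sub_le hγ (by linarith : 0 ≤ 1 + ν) hw hK hb θ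
      le_rfl ht hδ P hP
  constructor
  · rintro ⟨h0, h⟩
    refine ⟨h0, hdr.isGermSol_of_hasYoungLimit (by positivity) he hθ fun t ht0 ht1 => ?_⟩
    rw [h0]
    exact HasYoungLimit.of_sub_le hγ (σ := sigmaAvg w bhat) (h t ⟨ht0, ht1⟩)
      fun P δ hδ hP => (norm_sub_rev _ _).trans_le (hsub t ht1 P δ hδ hP)
  · rintro ⟨h0, h⟩
    refine ⟨h0, fun t ht => ?_⟩
    rw [← h0]
    exact (h.hasYoungLimit he.half_lt ht.2).of_sub_le hγ (hsub t ht.2)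

theorem IsGermSol.holderOnIcc {E : Type*} [NormedAddCommGroup E] [NormedSpace ℝ E] {M : ℝ}
    (hM : 0 ≤ M) (he : Exponents γ κ ν) {σ : ℝ → ℝ → E → E} (hσ : IsDriver M γ κ ν σ)
    {θ : ℝ → E} (h : IsGermSol γ σ θ) : HolderOnIcc γ θ := by
  obtain ⟨A, hA, hap⟩ := IsDriver.exists_apriori (E := E) hM he
  have key : ∀ s t, 0 ≤ s → s ≤ t → t ≤ 1 → ‖θ t - θ s‖ ≤ A * |t - s| ^ γ := by
    intro s t hs hst ht
    rw [abs_of_nonneg (by linarith)]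
    refine (hap σ θ hσ h s t hs hst ht).2.trans (mul_le_mul_of_nonneg_left ?_ hA)
    exact Real.rpow_le_rpow_of_exponent_ge_of_imp (by linarith) (by linarith) he.le
      fun _ h0 => absurd h0 (by linarith [he.half_lt, he.le])
  refine ⟨A, fun s hs t ht => ?_⟩
  rcases le_total s t with hst | hst
  · exact key s t hs.1 hst ht.2
  · rw [norm_sub_rev, abs_sub_comm]
    exact key t s ht.1 hst hs.2

theorem exists_lipschitz_flow (he : Exponents γ κ ν) (hν1 : ν ≤ 1)
    (hκ : κ = γ ∨ (κ = 1 ∧ 0 ≤ α + (1 + ν)))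
    (hw : ContinuousOn w (Set.Icc 0 1)) (hK : avgK w α γ < ⊤)
    (hb : FLnorm d (α + (1 + ν)) bhat < ⊤) :
    ∃ θ : Euc d → ℝ → Euc d,
      (∀ x : Euc d, HolderOnIcc γ (θ x) ∧ SolvesSigmaYoung w bhat x (θ x)) ∧
      (∀ (x : Euc d) (ψ : ℝ → Euc d), HolderOnIcc γ ψ → SolvesSigmaYoung w bhat x ψ →
        ∀ t ∈ Set.Icc (0 : ℝ) 1, ψ t = θ x t) ∧
      ∃ L : ℝ, ∀ t ∈ Set.Icc (0 : ℝ) 1, ∀ x y : Euc d, ‖θ x t - θ y t‖ ≤ L * ‖x - y‖ := by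
  have hb' : FLnorm d (α + (1 + ν)) (measPart bhat) < ⊤ :=
    (FLnorm_mono _ (norm_measPart_le bhat)).trans_lt hb
  have hm := compMeas_measPart bhat
  have hdr := isDriver_sigmaAvg he hν1 hκ hw hK hm hb' le_rfl
  have hM : 0 ≤ (d : ℝ) * (2 * ((avgK w α γ).toReal + 1) *
    (FLnorm d (α + (1 + ν)) (measPart bhat)).toReal) := by positivity
  obtain ⟨L, hL, hst⟩ := IsDriver.exists_stability (E := Euc d) hM he
  have hclose : DriverClose γ 0 (sigmaAvg w (measPart bhat)) (sigmaAvg w (measPart bhat)) :=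
    ⟨by simp, by simp⟩
  choose θ h0 hsol using exists_isGermSol_sigmaAvg he hν1 hκ hw hK hm hb'
  have hH : ∀ x, HolderOnIcc γ (θ x) := fun x => (hsol x).holderOnIcc hM he hdr
  refine ⟨θ, fun x => ⟨hH x, (solvesSigmaYoung_iff he hν1 hκ hw hK hb (hH x)).2 ⟨h0 x, hsol x⟩⟩,
    fun x ψ hψ hψs t ht => ?_, L, fun t ht x y => ?_⟩
  · obtain ⟨hψ0, hψg⟩ := (solvesSigmaYoung_iff he hν1 hκ hw hK hb hψ).1 hψs
    have := hst _ _ ψ (θ x) 0 hdr hdr le_rfl hclose hψg (hsol x) t ht.1 ht.2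
    rw [hψ0, h0, sub_self, norm_zero, add_zero, mul_zero] at this
    exact sub_eq_zero.1 (norm_le_zero_iff.1 this)
  · have := hst _ _ (θ x) (θ y) 0 hdr hdr le_rfl hclose (hsol x) (hsol y) t ht.1 ht.2
    rwa [h0, h0, add_zero] at this

end Main

/-- Lipschitz flow: if `b ∈ FL^{α+2}`, or `α+γ+1 ≥ 0` and
`b ∈ FL^{α+γ+1}`, then for every `x` the Young equation started at `x` has a unique
`γ`-Hölder solution `θ_·(x)`, and the flow `x ↦ θ_t(x)` is Lipschitz uniformly in time. -/
theorem statement12 (d : ℕ) (α γ : ℝ) (hγ : 1 / 2 < γ) (hγ1 : γ ≤ 1)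
    (w : ℝ → Euc d) (hw : ContinuousOn w (Set.Icc 0 1)) (hK : avgK w α γ < ⊤)
    (bhat : ℝ × Euc d → Fin d → ℂ)
    (hb : FLnorm d (α + 2) bhat < ⊤ ∨ (0 ≤ α + γ + 1 ∧ FLnorm d (α + γ + 1) bhat < ⊤)) :
    ∃ θ : Euc d → ℝ → Euc d,
      (∀ x : Euc d, HolderOnIcc γ (θ x) ∧ SolvesSigmaYoung w bhat x (θ x)) ∧
      (∀ (x : Euc d) (ψ : ℝ → Euc d), HolderOnIcc γ ψ → SolvesSigmaYoung w bhat x ψ →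
        ∀ t ∈ Set.Icc (0 : ℝ) 1, ψ t = θ x t) ∧
      ∃ L : ℝ, ∀ t ∈ Set.Icc (0 : ℝ) 1, ∀ x y : Euc d, ‖θ x t - θ y t‖ ≤ L * ‖x - y‖ := by
  rcases hb with hb | ⟨hβ, hb⟩
  · rw [show α + 2 = α + (1 + 1) by ring] at hb
    exact exists_lipschitz_flow (κ := γ) ⟨hγ, le_rfl, hγ1, one_mul γ, zero_le_one⟩ le_rfl
      (Or.inl rfl) hw hK hb
  · rw [show α + γ + 1 = α + (1 + γ) by ring] at hb hβ
    exact exists_lipschitz_flow (κ := 1) ⟨hγ, hγ1, le_rfl, mul_one γ, by linarith⟩ hγ1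
      (Or.inr ⟨rfl, hβ⟩) hw hK hb

end
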